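/- For every integer k ≥ b, the Foulkes–Howe map α is surjective in degree k: every homogeneous polynomial Q ∈ R of degree a·k is of the form α(P) for some homogeneous polynomial P ∈ S of degree k. (Theorem 1.2, surjectivity part.) -/

import Mathlib

open MvPolynomial

/-- The generic binary form `G = ∑_{i=0}^{b} u_i x^i y^{b-i}` of degree `b`,
viewed as a polynomial in two variables `x = X 0`, `y = X 1` with coefficients in
`R = MvPolynomial (Fin (b+1)) ℂ`. -/
noncomputable def genForm (b : ℕ) : MvPolynomial (Fin 2) (MvPolynomial (Fin (b + 1)) ℂ) :=
  ∑ i : Fin (b + 1),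
    MvPolynomial.C (MvPolynomial.X i) *
      MvPolynomial.X (0 : Fin 2) ^ (i : ℕ) * MvPolynomial.X (1 : Fin 2) ^ (b - (i : ℕ))

/-- The coefficient `c_j ∈ R` of `x^j y^{ab-j}` in `G^a`. -/
noncomputable def coeffC (a b j : ℕ) : MvPolynomial (Fin (b + 1)) ℂ :=
  MvPolynomial.coeff
    (Finsupp.single (0 : Fin 2) j + Finsupp.single (1 : Fin 2) (a * b - j))
    (genForm b ^ a)

/-- The Foulkes–Howe homomorphism `α : S → R`, `z_j ↦ c_j`. -/
noncomputable def FH (a b : ℕ) :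
    MvPolynomial (Fin (a * b + 1)) ℂ →ₐ[ℂ] MvPolynomial (Fin (b + 1)) ℂ :=
  MvPolynomial.aeval fun j : Fin (a * b + 1) => coeffC a b (j : ℕ)

set_option linter.unusedSectionVars false

namespace Dunkl

section Basic

variable {ι : Type*} [DecidableEq ι]

/-- The action of a permutation of the variables as a linear operator. -/
noncomputable def permEnd (σ : Equiv.Perm ι) : Module.End ℂ (MvPolynomial ι ℂ) :=
  (rename σ).toLinearMap

/-- Multiplication by a variable as a linear operator. -/
noncomputable def xEnd (i : ι) : Module.End ℂ (MvPolynomial ι ℂ) :=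
  LinearMap.mulLeft ℂ (X i)

@[simp] lemma permEnd_apply (σ : Equiv.Perm ι) (f : MvPolynomial ι ℂ) :
    permEnd σ f = rename σ f := rfl

@[simp] lemma xEnd_apply (i : ι) (f : MvPolynomial ι ℂ) : xEnd i f = X i * f := rfl

lemma X_sub_X_dvd (i j : ι) (f : MvPolynomial ι ℂ) :
    (X i - X j : MvPolynomial ι ℂ) ∣ f - rename (Equiv.swap i j) f := by
  induction f using MvPolynomial.induction_on with
  | C r => simp
  | add p q hp hq =>
    rw [map_add, add_sub_add_comm]
    exact dvd_add hp hq
  | mul_X p k hp =>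
    rw [map_mul, rename_X]
    have h : (X i - X j : MvPolynomial ι ℂ) ∣ X k - X (Equiv.swap i j k) := by
      rcases eq_or_ne k i with rfl | hki
      · simp
      · rcases eq_or_ne k j with rfl | hkj
        · rw [Equiv.swap_apply_right, ← neg_sub, neg_dvd]
        · simp [Equiv.swap_apply_of_ne_of_ne hki hkj]
    have := dvd_add (hp.mul_right (X k)) (h.mul_left (rename (Equiv.swap i j) p))
    convert this using 1
    ring

lemma X_sub_X_ne_zero {i j : ι} (h : i ≠ j) : (X i - X j : MvPolynomial ι ℂ) ≠ 0 :=
  sub_ne_zero.mpr fun e => h (X_injective e)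

open Classical in
/-- The divided difference `(f - σ f) / (X i - X j)`, where `σ` exchanges `X i` and `X j`. -/
noncomputable def divDiff (i j : ι) : Module.End ℂ (MvPolynomial ι ℂ) :=
  if h : i = j then 0 else
    { toFun := fun f => Classical.choose (X_sub_X_dvd i j f)
      map_add' := fun f g => by
        apply mul_left_cancel₀ (X_sub_X_ne_zero h)
        rw [mul_add, ← Classical.choose_spec (X_sub_X_dvd i j (f + g)),
          ← Classical.choose_spec (X_sub_X_dvd i j f),
          ← Classical.choose_spec (X_sub_X_dvd i j g), map_add]
        ring
      map_smul' := fun c f => by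
        apply mul_left_cancel₀ (X_sub_X_ne_zero h)
        rw [RingHom.id_apply, mul_smul_comm, ← Classical.choose_spec (X_sub_X_dvd i j (c • f)),
          ← Classical.choose_spec (X_sub_X_dvd i j f), map_smul, smul_sub] }

@[simp] lemma divDiff_self (i : ι) : divDiff i i = 0 := by simp [divDiff]

lemma sub_mul_divDiff (i j : ι) (f : MvPolynomial ι ℂ) :
    (X i - X j) * divDiff i j f = f - rename (Equiv.swap i j) f := by
  by_cases h : i = j
  · subst h; simp [Equiv.swap_self]
  · rw [divDiff, dif_neg h]
    exact (Classical.choose_spec (X_sub_X_dvd i j f)).symm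

lemma divDiff_eq_of_mul {i j : ι} (h : i ≠ j) {f g : MvPolynomial ι ℂ}
    (e : (X i - X j) * g = f - rename (Equiv.swap i j) f) : divDiff i j f = g :=
  mul_left_cancel₀ (X_sub_X_ne_zero h) ((sub_mul_divDiff i j f).trans e.symm)

lemma divDiff_eq_zero {i j : ι} {f : MvPolynomial ι ℂ}
    (e : rename (Equiv.swap i j) f = f) : divDiff i j f = 0 := by
  rcases eq_or_ne i j with rfl | h
  · simp
  · exact divDiff_eq_of_mul h (by rw [e]; ring)

/-- The divided difference of a single variable. -/
noncomputable def divCoef (i j k : ι) : ℂ := (if k = i then 1 else 0) - (if k = j then 1 else 0)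

lemma sum_divCoef_smul [Fintype ι] {V : Type*} [AddCommGroup V] [Module ℂ V] (i k : ι)
    (v : ι → V) :
    ∑ j, divCoef i j k • v j = (if k = i then ∑ j, v j else 0) - v k := by
  simp only [divCoef, sub_smul, Finset.sum_sub_distrib, ite_smul, one_smul, zero_smul,
    Finset.sum_ite_eq, Finset.mem_univ, if_true]
  split_ifs <;> simp

lemma X_sub_X_swap (i j k : ι) : (X k - X (Equiv.swap i j k) : MvPolynomial ι ℂ) =
    C (divCoef i j k) * (X i - X j) := by
  unfold divCoef
  rcases eq_or_ne k i with rfl | hki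
  · rcases eq_or_ne k j with rfl | hkj
    · simp
    · simp [hkj]
  · rcases eq_or_ne k j with rfl | hkj
    · simp [hki]
    · simp [hki, hkj, Equiv.swap_apply_of_ne_of_ne hki hkj]

lemma divDiff_X_mul (i j k : ι) (f : MvPolynomial ι ℂ) :
    divDiff i j (X k * f) =
      X k * divDiff i j f + divCoef i j k • rename (Equiv.swap i j) f := by
  rcases eq_or_ne i j with rfl | h
  · simp [divCoef]
  · apply divDiff_eq_of_mul h
    rw [map_mul, rename_X, smul_eq_C_mul]
    linear_combination (X k) * sub_mul_divDiff i j f -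
      rename (Equiv.swap i j) f * X_sub_X_swap i j k

lemma divDiff_X_mul' (i j k : ι) (f : MvPolynomial ι ℂ) :
    divDiff i j (X k * f) =
      X (Equiv.swap i j k) * divDiff i j f + divCoef i j k • f := by
  rcases eq_or_ne i j with rfl | h
  · simp [divCoef]
  · apply divDiff_eq_of_mul h
    rw [map_mul, rename_X, smul_eq_C_mul]
    linear_combination (X (Equiv.swap i j k)) * sub_mul_divDiff i j f -
      f * X_sub_X_swap i j k

@[simp] lemma divDiff_C (i j : ι) (r : ℂ) : divDiff i j (C r) = 0 :=
  divDiff_eq_zero (by simp)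

lemma divDiff_swap (i j : ι) : divDiff j i = - divDiff i j := by
  rcases eq_or_ne i j with rfl | h
  · simp
  · refine LinearMap.ext fun f => ?_
    apply divDiff_eq_of_mul h.symm
    rw [LinearMap.neg_apply, Equiv.swap_comm j i]
    linear_combination sub_mul_divDiff i j f

lemma rename_swap_divDiff (i j : ι) (f : MvPolynomial ι ℂ) :
    rename (Equiv.swap i j) (divDiff i j f) = divDiff i j f := by
  rcases eq_or_ne i j with rfl | h
  · simp
  · symm
    apply divDiff_eq_of_mul h
    have := congrArg (rename (Equiv.swap i j)) (sub_mul_divDiff i j f)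
    rw [map_mul, map_sub, map_sub, rename_X, rename_X, rename_rename, ← Equiv.coe_trans,
      Equiv.swap_swap, Equiv.swap_apply_left, Equiv.swap_apply_right, Equiv.coe_refl,
      rename_id_apply] at this
    linear_combination -this

lemma rename_divDiff (σ : Equiv.Perm ι) (i j : ι) (f : MvPolynomial ι ℂ) :
    rename σ (divDiff i j f) = divDiff (σ i) (σ j) (rename σ f) := by
  rcases eq_or_ne i j with rfl | h
  · simp
  · symm
    apply divDiff_eq_of_mul (σ.injective.ne h)
    have := congrArg (rename σ) (sub_mul_divDiff i j f)
    rw [map_mul, map_sub, map_sub, rename_X, rename_X, rename_rename] at this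
    rw [this, rename_rename]
    congr 3
    ext x
    simp [Equiv.swap_apply_def, apply_ite σ]

variable [Fintype ι] (a : ℂ)

/-- The Dunkl operators of the symmetric group, with parameter `-a`. -/
noncomputable def dunkl (i : ι) : Module.End ℂ (MvPolynomial ι ℂ) :=
  (pderiv i).toLinearMap - a • ∑ j, divDiff i j

lemma dunkl_apply (i : ι) (f : MvPolynomial ι ℂ) :
    dunkl a i f = pderiv i f - a • ∑ j, divDiff i j f := by
  simp [dunkl, LinearMap.sum_apply]

@[simp] lemma dunkl_C (i : ι) (r : ℂ) : dunkl a i (C r) = 0 := by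
  simp [dunkl_apply]

lemma dunkl_mul_xEnd (k i : ι) :
    dunkl a k * xEnd i = xEnd i * dunkl a k +
      (if k = i then 1 - a • ∑ j, permEnd (Equiv.swap i j) else 0) +
      a • permEnd (Equiv.swap i k) := by
  refine LinearMap.ext fun f => ?_
  have h1 : ∀ j, divDiff k j (X i * f) =
      X i * divDiff k j f + divCoef k j i • rename (Equiv.swap k j) f :=
    fun j => divDiff_X_mul k j i f
  have h2 : ∑ j, divCoef k j i • rename (Equiv.swap k j) f =
      (if k = i then ∑ j, rename (Equiv.swap i j) f else 0) - rename (Equiv.swap i k) f := by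
    rw [sum_divCoef_smul, Equiv.swap_comm k i]
    by_cases h : i = k
    · subst h; simp
    · simp [h, Ne.symm h]
  simp only [Module.End.mul_apply, xEnd_apply, LinearMap.add_apply, LinearMap.smul_apply,
    permEnd_apply, dunkl_apply, h1, Finset.sum_add_distrib, h2, ← Finset.mul_sum]
  by_cases h : k = i
  · subst h
    simp [Derivation.leibniz, LinearMap.sum_apply, smul_sub, mul_sub, smul_add]
    abel
  · simp [h, Derivation.leibniz, pderiv_X, Ne.symm h, mul_sub]
    abel

lemma permEnd_mul_dunkl (σ : Equiv.Perm ι) (i : ι) :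
    permEnd σ * dunkl a i = dunkl a (σ i) * permEnd σ := by
  refine LinearMap.ext fun f => ?_
  simp only [Module.End.mul_apply, permEnd_apply, dunkl_apply, map_sub, map_smul, map_sum,
    rename_divDiff]
  rw [pderiv_rename σ.injective]
  congr 2
  exact Equiv.sum_comp σ (fun j => divDiff (σ i) j (rename σ f))

lemma permEnd_one : permEnd (1 : Equiv.Perm ι) = 1 := by
  refine LinearMap.ext fun f => ?_
  simp

end Basic

section Commute

variable {ι : Type*} [DecidableEq ι] [Fintype ι] (a : ℂ)

lemma bracket_mul_xEnd_self {i j : ι} (h : i ≠ j) :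
    (dunkl a i * dunkl a j - dunkl a j * dunkl a i) * xEnd i =
      xEnd i * (dunkl a i * dunkl a j - dunkl a j * dunkl a i) := by
  have hs : (∑ l, permEnd (Equiv.swap i l)) * dunkl a j -
      dunkl a j * ∑ l, permEnd (Equiv.swap i l) =
        (dunkl a i - dunkl a j) * permEnd (Equiv.swap i j) := by
    rw [Finset.sum_mul, Finset.mul_sum, ← Finset.sum_sub_distrib]
    rw [Finset.sum_eq_single j]
    · rw [permEnd_mul_dunkl, Equiv.swap_apply_right, sub_mul]
    · intro l _ hl
      rw [permEnd_mul_dunkl, Equiv.swap_apply_of_ne_of_ne h.symm hl.symm, sub_self]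
    · simp
  have h1 := dunkl_mul_xEnd a i i
  have h2 := dunkl_mul_xEnd a j i
  rw [if_pos rfl, Equiv.swap_self, ← Equiv.Perm.one_def, permEnd_one] at h1
  rw [if_neg h.symm, add_zero] at h2
  have h3 := permEnd_mul_dunkl a (Equiv.swap i j) i
  rw [Equiv.swap_apply_left] at h3
  set S := ∑ l, permEnd (Equiv.swap i l)
  set s := permEnd (Equiv.swap i j)
  calc (dunkl a i * dunkl a j - dunkl a j * dunkl a i) * xEnd i
      = dunkl a i * (dunkl a j * xEnd i) - dunkl a j * (dunkl a i * xEnd i) := by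
        rw [sub_mul, mul_assoc, mul_assoc]
    _ = (dunkl a i * xEnd i) * dunkl a j + a • (dunkl a i * s)
          - (dunkl a j * xEnd i) * dunkl a i - dunkl a j + a • (dunkl a j * S)
          - a • dunkl a j := by
        rw [h1, h2]
        simp only [mul_add, mul_sub, mul_smul_comm, mul_one, h1, h2, add_mul, sub_mul,
          smul_mul_assoc, one_mul, ← mul_assoc]
        abel
    _ = xEnd i * (dunkl a i * dunkl a j - dunkl a j * dunkl a i) +
          a • (dunkl a i * s - s * dunkl a i - (S * dunkl a j - dunkl a j * S)) := by
        rw [h1, h2]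
        simp only [mul_sub, smul_sub, add_mul, sub_mul, smul_mul_assoc, one_mul, mul_assoc]
        abel
    _ = _ := by
        rw [hs, h3, sub_mul, sub_self, smul_zero, add_zero]

lemma bracket_mul_xEnd (i j k : ι) :
    (dunkl a i * dunkl a j - dunkl a j * dunkl a i) * xEnd k =
      xEnd k * (dunkl a i * dunkl a j - dunkl a j * dunkl a i) := by
  rcases eq_or_ne i j with rfl | h
  · simp
  rcases eq_or_ne k i with rfl | hi
  · exact bracket_mul_xEnd_self a h
  rcases eq_or_ne k j with rfl | hj
  · have := bracket_mul_xEnd_self a h.symm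
    rw [← neg_sub (dunkl a k * dunkl a i)]
    exact (neg_mul _ _).trans ((congrArg Neg.neg this).trans (mul_neg _ _).symm)
  have h1 := dunkl_mul_xEnd a i k
  have h2 := dunkl_mul_xEnd a j k
  rw [if_neg hi.symm, add_zero] at h1
  rw [if_neg hj.symm, add_zero] at h2
  have h3 := permEnd_mul_dunkl a (Equiv.swap k i) j
  have h4 := permEnd_mul_dunkl a (Equiv.swap k j) i
  rw [Equiv.swap_apply_of_ne_of_ne hj.symm h.symm] at h3
  rw [Equiv.swap_apply_of_ne_of_ne hi.symm h] at h4
  rw [sub_mul, mul_assoc, mul_assoc, h1, h2, mul_add, mul_add, ← mul_assoc, ← mul_assoc, h1, h2,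
    add_mul, add_mul]
  simp only [mul_smul_comm, smul_mul_assoc, h3, h4, mul_sub, mul_assoc]
  abel

lemma eq_zero_of_commute_xEnd {T : Module.End ℂ (MvPolynomial ι ℂ)} (h1 : ∀ r, T (C r) = 0)
    (h : ∀ k, T * xEnd k = xEnd k * T) : T = 0 := by
  refine LinearMap.ext fun f => ?_
  induction f using MvPolynomial.induction_on with
  | C r => simpa using h1 r
  | add p q hp hq => rw [map_add, hp, hq]; simp
  | mul_X p k hp =>
    have := LinearMap.congr_fun (h k) p
    simp only [Module.End.mul_apply, xEnd_apply] at this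
    rw [mul_comm, this, hp]
    simp

lemma dunkl_comm (i j : ι) : dunkl a i * dunkl a j = dunkl a j * dunkl a i :=
  sub_eq_zero.mp <| eq_zero_of_commute_xEnd (by simp) (bracket_mul_xEnd a i j)

open scoped IsMulCommutative in
/-- Substitution of pairwise commuting elements into a polynomial. -/
noncomputable def _root_.MvPolynomial.aevalComm {E : Type*} [Ring E] [Algebra ℂ E] (d : ι → E)
    (hd : ∀ i j, d i * d j = d j * d i) : MvPolynomial ι ℂ →ₐ[ℂ] E :=
  haveI : IsMulCommutative (Algebra.adjoin ℂ (Set.range d)) :=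
    Algebra.isMulCommutative_adjoin ℂ (by rintro _ ⟨i, rfl⟩ _ ⟨j, rfl⟩; exact hd i j)
  (Subalgebra.val _).comp
    (aeval fun i => (⟨d i, Algebra.subset_adjoin ⟨i, rfl⟩⟩ : Algebra.adjoin ℂ (Set.range d)))

open scoped IsMulCommutative in
@[simp] lemma _root_.MvPolynomial.aevalComm_X {E : Type*} [Ring E] [Algebra ℂ E] (d : ι → E)
    (hd : ∀ i j, d i * d j = d j * d i) (i : ι) : aevalComm d hd (X i) = d i := by
  simp [aevalComm]

/-- Substitution of the Dunkl operators into a polynomial. -/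
noncomputable def dunklHom : MvPolynomial ι ℂ →ₐ[ℂ] Module.End ℂ (MvPolynomial ι ℂ) :=
  aevalComm (dunkl a) (dunkl_comm a)

@[simp] lemma dunklHom_X (i : ι) : dunklHom a (X i) = dunkl a i := aevalComm_X _ _ _

lemma dunklHom_C (r : ℂ) : dunklHom (ι := ι) a (C r) = r • 1 := by
  rw [← algebraMap_eq, AlgHom.commutes, Algebra.algebraMap_eq_smul_one]

lemma permEnd_mul_dunklHom (σ : Equiv.Perm ι) (P : MvPolynomial ι ℂ) :
    permEnd σ * dunklHom a P = dunklHom a (rename σ P) * permEnd σ := by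
  induction P using MvPolynomial.induction_on with
  | C r => simp only [dunklHom_C, rename_C, mul_smul_comm, smul_mul_assoc, mul_one, one_mul]
  | add p q hp hq => simp only [map_add, mul_add, add_mul, hp, hq]
  | mul_X p k hp =>
    rw [map_mul, map_mul, map_mul, rename_X, dunklHom_X, dunklHom_X, ← mul_assoc, hp, mul_assoc,
      permEnd_mul_dunkl, mul_assoc]

lemma dunkl_mul_xEnd' (k i : ι) :
    dunkl a k * xEnd i = xEnd i * dunkl a k + (if k = i then 1 else 0) -
      a • ∑ j, divCoef i j k • permEnd (Equiv.swap i j) := by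
  rw [dunkl_mul_xEnd]
  have := sum_divCoef_smul i k fun j => permEnd (Equiv.swap i j)
  rw [this]
  by_cases h : k = i
  · simp only [h, if_true, smul_sub]; abel
  · simp [h]

lemma dunklHom_mul_xEnd (P : MvPolynomial ι ℂ) (i : ι) :
    dunklHom a P * xEnd i = xEnd i * dunklHom a P + dunklHom a (pderiv i P) -
      a • ∑ j, dunklHom a (divDiff i j P) * permEnd (Equiv.swap i j) := by
  induction P using MvPolynomial.induction_on with
  | C r =>
    simp only [dunklHom_C, mul_smul_comm, smul_mul_assoc, mul_one, one_mul, pderiv_C, divDiff_C,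
      map_zero, zero_mul, Finset.sum_const_zero, smul_zero, add_zero, sub_zero]
  | add p q hp hq =>
    simp only [map_add, mul_add, add_mul, hp, hq, Finset.sum_add_distrib, smul_add]
    abel
  | mul_X p k hp =>
    have h1 : ∀ j, dunklHom a (divDiff i j (p * X k)) * permEnd (Equiv.swap i j) =
        dunklHom a (divDiff i j p) * permEnd (Equiv.swap i j) * dunkl a k +
        dunklHom a p * (divCoef i j k • permEnd (Equiv.swap i j)) := by
      intro j
      rw [mul_comm p, divDiff_X_mul', mul_comm (X _), map_add, map_mul, map_smul, dunklHom_X,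
        mul_assoc (dunklHom a (divDiff i j p)), permEnd_mul_dunkl, add_mul, smul_mul_assoc,
        mul_smul_comm, mul_assoc]
    have h2 : pderiv i (p * X k) = pderiv i p * X k + (if k = i then p else 0) := by
      by_cases h : k = i
      · subst h; simp [Derivation.leibniz]; ring
      · simp [h, Derivation.leibniz, pderiv_X, mul_comm]
    simp only [h1, h2, Finset.sum_add_distrib, ← Finset.mul_sum, ← Finset.sum_mul, map_add, map_mul,
      dunklHom_X, smul_add]
    rw [mul_assoc, dunkl_mul_xEnd', mul_sub, mul_add, ← mul_assoc, hp, mul_smul_comm, sub_mul,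
      add_mul, smul_mul_assoc]
    by_cases h : k = i
    · simp only [h, if_true, mul_one, mul_assoc]; abel
    · simp only [h, if_false, mul_zero, map_zero, add_zero, mul_assoc]; abel

/-- The contravariant pairing attached to the Dunkl operators. -/
noncomputable def pairing (P f : MvPolynomial ι ℂ) : ℂ := constantCoeff (dunklHom a P f)

lemma constantCoeff_rename_perm (σ : Equiv.Perm ι) (f : MvPolynomial ι ℂ) :
    constantCoeff (rename σ f) = constantCoeff f := by
  simp

lemma pairing_X_mul (P f : MvPolynomial ι ℂ) (i : ι) :
    pairing a P (X i * f) = pairing a (dunkl a i P) f := by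
  have h := LinearMap.congr_fun (dunklHom_mul_xEnd a P i) f
  simp only [Module.End.mul_apply, xEnd_apply, LinearMap.add_apply, LinearMap.sub_apply,
    LinearMap.smul_apply, LinearMap.sum_apply] at h
  have h1 : ∀ j, constantCoeff (dunklHom a (divDiff i j P) (permEnd (Equiv.swap i j) f)) =
      constantCoeff (dunklHom a (divDiff i j P) f) := by
    intro j
    rw [← constantCoeff_rename_perm (Equiv.swap i j) (dunklHom a (divDiff i j P) f)]
    have := LinearMap.congr_fun (permEnd_mul_dunklHom a (Equiv.swap i j) (divDiff i j P)) f
    simp only [Module.End.mul_apply, permEnd_apply] at this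
    rw [this, rename_swap_divDiff, permEnd_apply]
  unfold pairing
  rw [h, dunkl_apply]
  simp only [map_sub, map_add, map_mul, constantCoeff_X, zero_mul, zero_add, smul_eq_C_mul, map_sum,
    constantCoeff_C, h1, LinearMap.sub_apply, algHom_C]
  simp [Finset.mul_sum]

lemma pairing_C (P : MvPolynomial ι ℂ) (r : ℂ) : pairing a P (C r) = r * constantCoeff P := by
  unfold pairing
  induction P using MvPolynomial.induction_on with
  | C s => simp [mul_comm]
  | add p q hp hq => rw [map_add, LinearMap.add_apply, map_add, hp, hq, map_add, mul_add]
  | mul_X p k hp => simp [map_mul, dunklHom_X]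

lemma pairing_add (P f g : MvPolynomial ι ℂ) :
    pairing a P (f + g) = pairing a P f + pairing a P g := by
  simp [pairing]

lemma pairing_symm (P f : MvPolynomial ι ℂ) : pairing a P f = pairing a f P := by
  induction f using MvPolynomial.induction_on generalizing P with
  | C r => rw [pairing_C, pairing, dunklHom_C]; simp
  | add p q hp hq => rw [pairing_add, hp, hq]; simp [pairing]
  | mul_X p k hp =>
    rw [mul_comm, pairing_X_mul, hp, pairing, pairing, mul_comm, map_mul, dunklHom_X]; rfl

end Commute

section Singular

variable {ι : Type*} [DecidableEq ι] [Fintype ι]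

/-- A polynomial killed by all Dunkl operators. -/
def IsSingular (a : ℂ) (f : MvPolynomial ι ℂ) : Prop := ∀ i, dunkl a i f = 0

/-- Restriction of a polynomial to the `i`-th coordinate axis. -/
noncomputable def axis (i : ι) : MvPolynomial ι ℂ →ₐ[ℂ] Polynomial ℂ :=
  aeval (Pi.single i Polynomial.X)

lemma axis_X (i k : ι) : axis i (X k) = if k = i then Polynomial.X else 0 := by
  simp [axis, Pi.single_apply]

lemma axis_rename_swap (i j : ι) (f : MvPolynomial ι ℂ) :
    axis i (rename (Equiv.swap i j) f) = axis j f := by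
  rw [axis, aeval_rename, axis]
  congr 2
  ext1 k
  simp only [Function.comp_apply, Pi.single_apply, Equiv.swap_apply_eq_iff, Equiv.swap_apply_left]

lemma axis_pderiv (i : ι) (f : MvPolynomial ι ℂ) :
    axis i (pderiv i f) = Polynomial.derivative (axis i f) := by
  induction f using MvPolynomial.induction_on with
  | C r => simp [axis]
  | add p q hp hq => simp [hp, hq]
  | mul_X p k hp =>
    by_cases h : k = i
    · subst h; simp [Derivation.leibniz, hp, axis_X]; ring
    · simp [Derivation.leibniz, hp, axis_X, h, pderiv_X]

lemma X_mul_axis_divDiff (i j : ι) (f : MvPolynomial ι ℂ) :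
    Polynomial.X * axis i (divDiff i j f) = axis i f - axis j f := by
  rcases eq_or_ne i j with rfl | h
  · simp
  · have := congrArg (axis i) (sub_mul_divDiff i j f)
    rwa [map_mul, map_sub, map_sub, axis_X, axis_X, if_pos rfl, if_neg h.symm, sub_zero,
      axis_rename_swap] at this

lemma IsSingular.coeff_axis_eq_zero {a : ℂ} {f : MvPolynomial ι ℂ} (hf : IsSingular a f) {N : ℕ}
    (hN : N ≠ 0) (hNa : (N : ℂ) ≠ a * Fintype.card ι) (i : ι) : (axis i f).coeff N = 0 := by
  set c : ι → ℂ := fun i => (axis i f).coeff N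
  have key : ∀ i, (N : ℂ) * c i = a * (Fintype.card ι * c i - ∑ j, c j) := by
    intro i
    have h := congrArg (fun g => (Polynomial.X * axis i g).coeff N) (hf i)
    simp only [dunkl_apply, map_sub, map_smul, map_sum, mul_sub, mul_smul_comm, Finset.mul_sum,
      X_mul_axis_divDiff, axis_pderiv, map_zero, mul_zero, Polynomial.coeff_zero,
      Polynomial.coeff_sub, Polynomial.coeff_smul, Polynomial.finsetSum_coeff, smul_eq_mul] at h
    obtain ⟨n, rfl⟩ := Nat.exists_eq_succ_of_ne_zero hN
    rw [Polynomial.coeff_X_mul, Polynomial.coeff_derivative] at h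
    simp only [Finset.sum_sub_distrib, Finset.sum_const, Finset.card_univ, nsmul_eq_mul] at h
    simp only [c]
    push_cast
    rw [← Finset.mul_sum] at h
    linear_combination h
  have hS : ∑ j, c j = 0 := by
    have := Finset.sum_congr (rfl : (Finset.univ : Finset ι) = _) fun i _ => key i
    rw [← Finset.mul_sum, ← Finset.mul_sum, Finset.sum_sub_distrib, ← Finset.mul_sum,
      Finset.sum_const, Finset.card_univ, nsmul_eq_mul, sub_self, mul_zero] at this
    exact (mul_eq_zero.mp this).resolve_left (Nat.cast_ne_zero.mpr hN)
  have := key i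
  rw [hS] at this
  exact (mul_eq_zero.mp (show ((N : ℂ) - a * Fintype.card ι) * c i = 0 by
    linear_combination this)).resolve_left (sub_ne_zero.mpr hNa)

lemma IsSingular.pairing_eq {a : ℂ} {f : MvPolynomial ι ℂ} (hf : IsSingular a f)
    (P : MvPolynomial ι ℂ) : pairing a P f = constantCoeff P * constantCoeff f := by
  unfold pairing
  induction P using MvPolynomial.induction_on with
  | C s => simp
  | add p q hp hq => rw [map_add, LinearMap.add_apply, map_add, hp, hq, map_add, add_mul]
  | mul_X p k hp => simp [map_mul, dunklHom_X, hf k]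

/-- Integration of a polynomial in `w` from `0` to each variable, summed over the variables. -/
noncomputable def sumIntegral :
    Polynomial (MvPolynomial ι ℂ) →ₗ[MvPolynomial ι ℂ] MvPolynomial ι ℂ :=
  Polynomial.lsum fun k => LinearMap.toSpanSingleton _ _ (((k : ℂ) + 1)⁻¹ • psum ι ℂ (k + 1))

lemma sumIntegral_monomial (k : ℕ) (c : MvPolynomial ι ℂ) :
    sumIntegral (Polynomial.monomial k c) = c * (((k : ℂ) + 1)⁻¹ • psum ι ℂ (k + 1)) := by
  simp [sumIntegral, Polynomial.lsum_apply, Polynomial.sum_monomial_index]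

lemma sumIntegral_C_mul (c : MvPolynomial ι ℂ) (h : Polynomial (MvPolynomial ι ℂ)) :
    sumIntegral (Polynomial.C c * h) = c * sumIntegral h := by
  rw [← Polynomial.smul_eq_C_mul, map_smul, smul_eq_mul]

lemma rename_sumIntegral (σ : Equiv.Perm ι) (h : Polynomial (MvPolynomial ι ℂ)) :
    rename σ (sumIntegral h) =
      sumIntegral (h.map (rename σ : MvPolynomial ι ℂ →ₐ[ℂ] _).toRingHom) := by
  induction h using Polynomial.induction_on' with
  | add p q hp hq => simp [hp, hq]
  | monomial n c => simp [sumIntegral_monomial]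

lemma pderiv_psum (j : ι) (k : ℕ) : pderiv j (psum ι ℂ (k + 1)) = ((k : ℂ) + 1) • X j ^ k := by
  rw [psum, map_sum, Finset.sum_eq_single j]
  · simp [Derivation.leibniz_pow, smul_eq_C_mul]
  · intro l _ hl
    simp [Derivation.leibniz_pow, pderiv_X, hl]
  · simp

/-- The partial derivative `∂/∂X j`, applied to the coefficients of a polynomial. -/
noncomputable def coeffDeriv (j : ι) :
    Derivation ℂ (Polynomial (MvPolynomial ι ℂ)) (Polynomial (MvPolynomial ι ℂ)) :=
  PolynomialModule.equivPolynomialSelf.compDer (pderiv j).mapCoeffs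

lemma coeffDeriv_monomial (j : ι) (n : ℕ) (c : MvPolynomial ι ℂ) :
    coeffDeriv j (Polynomial.monomial n c) = Polynomial.monomial n (pderiv j c) := by
  ext1 m
  change pderiv j ((Polynomial.monomial n c).coeff m) = _
  rw [Polynomial.coeff_monomial, Polynomial.coeff_monomial]
  split_ifs <;> simp

lemma coeffDeriv_X_sub_C (j : ι) (c : MvPolynomial ι ℂ) :
    coeffDeriv j (Polynomial.X - Polynomial.C c) = - Polynomial.C (pderiv j c) := by
  rw [map_sub, ← Polynomial.monomial_one_one_eq_X, ← Polynomial.monomial_zero_left,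
    coeffDeriv_monomial, coeffDeriv_monomial]
  simp

lemma pderiv_sumIntegral (j : ι) (h : Polynomial (MvPolynomial ι ℂ)) :
    pderiv j (sumIntegral h) =
      sumIntegral (coeffDeriv j h) + h.eval (X j) := by
  induction h using Polynomial.induction_on' with
  | add p q hp hq => simp only [map_add, hp, hq, Polynomial.eval_add]; ring
  | monomial n c =>
    have : ((n : ℂ) + 1) ≠ 0 := Nat.cast_add_one_ne_zero n
    rw [coeffDeriv_monomial, sumIntegral_monomial, sumIntegral_monomial,
      Derivation.leibniz, Derivation.map_smul, pderiv_psum, smul_smul, inv_mul_cancel₀ this,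
      Polynomial.eval_monomial]
    simp [smul_eq_mul]; ring_nf

lemma sumIntegral_derivative (h : Polynomial (MvPolynomial ι ℂ)) :
    sumIntegral (Polynomial.derivative h) = ∑ l, (h.eval (X l) - h.eval 0) := by
  induction h using Polynomial.induction_on' with
  | add p q hp hq =>
    simp only [map_add, hp, hq, Polynomial.eval_add, ← Finset.sum_add_distrib]
    exact Finset.sum_congr rfl fun _ _ => by ring
  | monomial n c =>
    rw [Polynomial.derivative_monomial, sumIntegral_monomial]
    cases n with
    | zero => simp
    | succ n =>
      have : ((n : ℂ) + 1) ≠ 0 := Nat.cast_add_one_ne_zero n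
      simp only [Nat.add_sub_cancel, Polynomial.eval_monomial, zero_pow n.succ_ne_zero, mul_zero,
        sub_zero, ← Finset.mul_sum, psum, mul_assoc]
      congr 1
      rw [smul_eq_C_mul, ← mul_assoc, ← map_natCast (C : ℂ →+* MvPolynomial ι ℂ), ← C_mul]
      push_cast
      rw [mul_inv_cancel₀ this, C_1, one_mul]

lemma constantCoeff_sumIntegral (h : Polynomial (MvPolynomial ι ℂ)) :
    constantCoeff (sumIntegral h) = 0 := by
  induction h using Polynomial.induction_on' with
  | add p q hp hq => simp [hp, hq]
  | monomial n c => simp [sumIntegral_monomial, psum, smul_eq_C_mul]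

/-- The product `∏ m, (w - X m) ^ a`. -/
noncomputable def masterPoly (ι : Type*) [Fintype ι] (a : ℕ) : Polynomial (MvPolynomial ι ℂ) :=
  ∏ m, (Polynomial.X - Polynomial.C (X m)) ^ a

/-- The product `∏ m, (w - X m) ^ a` divided by `w - X i`. -/
noncomputable def masterQuot (a : ℕ) (i : ι) : Polynomial (MvPolynomial ι ℂ) :=
  (Polynomial.X - Polynomial.C (X i)) ^ (a - 1) *
    ∏ m ∈ Finset.univ.erase i, (Polynomial.X - Polynomial.C (X m)) ^ a

variable {a : ℕ}

lemma mul_masterQuot (ha : 1 ≤ a) (i : ι) :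
    (Polynomial.X - Polynomial.C (X i)) * masterQuot a i = masterPoly ι a := by
  rw [masterQuot, masterPoly, ← mul_assoc, ← pow_succ', Nat.sub_add_cancel ha,
    Finset.mul_prod_erase Finset.univ (fun m => (Polynomial.X - Polynomial.C (X m)) ^ a)
      (Finset.mem_univ i)]

lemma map_masterPoly (σ : Equiv.Perm ι) :
    (masterPoly ι a).map (rename σ : MvPolynomial ι ℂ →ₐ[ℂ] _).toRingHom = masterPoly ι a := by
  simp only [masterPoly, Polynomial.map_prod, Polynomial.map_pow, Polynomial.map_sub,
    Polynomial.map_X, Polynomial.map_C, AlgHom.toRingHom_eq_coe, RingHom.coe_coe, rename_X]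
  exact Equiv.prod_comp σ fun m => (Polynomial.X - Polynomial.C (X m : MvPolynomial ι ℂ)) ^ a

lemma map_masterQuot (ha : 1 ≤ a) (σ : Equiv.Perm ι) (i : ι) :
    (masterQuot a i).map (rename σ : MvPolynomial ι ℂ →ₐ[ℂ] _).toRingHom =
      masterQuot a (σ i) := by
  have h := congrArg (Polynomial.map (rename σ : MvPolynomial ι ℂ →ₐ[ℂ] _).toRingHom)
    (mul_masterQuot ha i)
  rw [map_masterPoly, Polynomial.map_mul, ← mul_masterQuot ha (σ i)] at h
  simp only [Polynomial.map_sub, Polynomial.map_X, Polynomial.map_C, AlgHom.toRingHom_eq_coe,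
    RingHom.coe_coe, rename_X] at h
  exact mul_left_cancel₀ (Polynomial.X_sub_C_ne_zero _) h

lemma derivation_prod_eq_zero {R M κ : Type*} [CommRing R] [Algebra ℂ R]
    [AddCommGroup M] [Module R M] [Module ℂ M] (d : Derivation ℂ R M) (s : Finset κ) (v : κ → R)
    (h : ∀ m ∈ s, d (v m) = 0) : d (∏ m ∈ s, v m) = 0 :=
  Finset.prod_induction v (fun x => d x = 0)
    (fun x y hx hy => by rw [Derivation.leibniz, hx, hy]; simp) (by simp) h

lemma coeffDeriv_masterPoly (j : ι) :
    coeffDeriv j (masterPoly ι a) = - (a • masterQuot a j) := by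
  rw [masterPoly, ← Finset.mul_prod_erase _ _ (Finset.mem_univ j), Derivation.leibniz,
    derivation_prod_eq_zero, Derivation.leibniz_pow, coeffDeriv_X_sub_C, masterQuot]
  · simp [smul_eq_mul]; ring_nf
  · intro m hm
    rw [Derivation.leibniz_pow, coeffDeriv_X_sub_C, pderiv_X_of_ne (Finset.ne_of_mem_erase hm)]
    simp

lemma derivative_masterPoly :
    Polynomial.derivative (masterPoly ι a) = ∑ i, a • masterQuot a i := by
  rw [masterPoly, Polynomial.derivative_prod_finset]
  refine Finset.sum_congr rfl fun i _ => ?_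
  rw [masterQuot, Polynomial.derivative_X_sub_C_pow]
  simp; ring

lemma eval_masterQuot (ha : 1 ≤ a) {i j : ι} (h : j ≠ i) : (masterQuot a i).eval (X j) = 0 := by
  rw [masterQuot, Polynomial.eval_mul, Polynomial.eval_prod,
    Finset.prod_eq_zero (Finset.mem_erase.mpr ⟨h, Finset.mem_univ j⟩), mul_zero]
  simp [Nat.one_le_iff_ne_zero.mp ha]

lemma sumIntegral_coeffDeriv_masterQuot (ha : 1 ≤ a) {i j : ι} (h : j ≠ i) :
    sumIntegral (coeffDeriv j (masterQuot a i)) =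
      (a : ℂ) • divDiff j i (sumIntegral (masterQuot a i)) := by
  apply mul_left_cancel₀ (X_sub_X_ne_zero h)
  have h1 : (Polynomial.X - Polynomial.C (X i)) * coeffDeriv j (masterQuot a i) =
      - (a • masterQuot a j) := by
    rw [← coeffDeriv_masterPoly, ← mul_masterQuot ha i, Derivation.leibniz, coeffDeriv_X_sub_C,
      pderiv_X_of_ne h.symm]
    simp
  have h2 : Polynomial.C (X j - X i) * coeffDeriv j (masterQuot a i) =
      a • (masterQuot a i - masterQuot a j) := by
    apply mul_left_cancel₀ (Polynomial.X_sub_C_ne_zero (X i : MvPolynomial ι ℂ))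
    apply mul_left_cancel₀ (Polynomial.X_sub_C_ne_zero (X j : MvPolynomial ι ℂ))
    simp only [nsmul_eq_mul, Polynomial.C_sub] at h1 ⊢
    linear_combination (Polynomial.C (X j) - Polynomial.C (X i)) *
      (Polynomial.X - Polynomial.C (X j)) * h1 - a * (Polynomial.X - Polynomial.C (X j)) *
        mul_masterQuot ha i + a * (Polynomial.X - Polynomial.C (X j)) * mul_masterQuot ha j
  rw [mul_smul_comm, sub_mul_divDiff, ← sumIntegral_C_mul, h2, rename_sumIntegral,
    map_masterQuot ha, Equiv.swap_apply_right, map_nsmul, map_sub, Nat.cast_smul_eq_nsmul]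

lemma dunkl_sumIntegral_masterQuot (ha : 1 ≤ a) {i j : ι} (h : j ≠ i) :
    dunkl (a : ℂ) j (sumIntegral (masterQuot a i)) = 0 := by
  rw [dunkl_apply, pderiv_sumIntegral, eval_masterQuot ha h, add_zero,
    sumIntegral_coeffDeriv_masterQuot ha h, Finset.sum_eq_single i, sub_self]
  · intro m _ hm
    apply divDiff_eq_zero
    rw [rename_sumIntegral, map_masterQuot ha, Equiv.swap_apply_of_ne_of_ne h.symm hm.symm]
  · simp

lemma sum_sumIntegral_masterQuot (ha : 1 ≤ a) [Nonempty ι] :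
    ∑ i, (a : ℂ) • sumIntegral (masterQuot a i) =
      - ((Fintype.card ι : ℂ) • ∏ m, (- X m : MvPolynomial ι ℂ) ^ a) := by
  simp only [Nat.cast_smul_eq_nsmul, ← map_nsmul]
  rw [← map_sum, ← derivative_masterPoly, sumIntegral_derivative]
  have h : ∀ l, (masterPoly ι a).eval (X l) = 0 := fun l => by
    rw [← mul_masterQuot ha l]; simp
  simp only [h, zero_sub]
  simp [masterPoly, Polynomial.eval_prod]

end Singular

section SingularConst

variable {ι : Type*} [DecidableEq ι] [Fintype ι]

lemma dunklHom_apply_eq_aeval (c : ℂ) {i : ι} {g : MvPolynomial ι ℂ}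
    (hg : ∀ j, j ≠ i → dunkl c j g = 0) (f : MvPolynomial ι ℂ) :
    dunklHom c f g = Polynomial.aeval (dunkl c i) (axis i f) g := by
  induction f using MvPolynomial.induction_on with
  | C r => simp [axis]
  | add p q hp hq => simp [hp, hq]
  | mul_X p k hp =>
    rw [mul_comm, map_mul, dunklHom_X, Module.End.mul_apply, map_mul, axis_X]
    split_ifs with h
    · rw [map_mul, Polynomial.aeval_X, Module.End.mul_apply, hp, h]
    · rw [zero_mul, map_zero, LinearMap.zero_apply, ← Module.End.mul_apply, ← dunklHom_X,
        ← map_mul, mul_comm, map_mul, Module.End.mul_apply, dunklHom_X, hg k h, map_zero]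

lemma sum_dunkl_apply (c : ℂ) (f : MvPolynomial ι ℂ) :
    (∑ j, dunkl c j) f = ∑ j, pderiv j f := by
  have h : ∑ i, ∑ j, divDiff i j f = 0 := by
    have h1 : ∑ i, ∑ j, divDiff i j f = - ∑ i, ∑ j, divDiff i j f := by
      conv_lhs => rw [Finset.sum_comm]
      simp only [← Finset.sum_neg_distrib]
      exact Finset.sum_congr rfl fun i _ => Finset.sum_congr rfl fun j _ => by
        rw [divDiff_swap i j]; rfl
    exact self_eq_neg.mp h1
  simp only [LinearMap.sum_apply, dunkl_apply, Finset.sum_sub_distrib, ← Finset.smul_sum, h,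
    smul_zero, sub_zero]

/-- Restriction of a polynomial to the diagonal line. -/
noncomputable def diagonal : MvPolynomial ι ℂ →ₐ[ℂ] Polynomial ℂ := aeval fun _ => Polynomial.X

lemma diagonal_sum_pderiv (f : MvPolynomial ι ℂ) :
    diagonal (∑ j, pderiv j f) = Polynomial.derivative (diagonal f) := by
  induction f using MvPolynomial.induction_on with
  | C r => simp [diagonal]
  | add p q hp hq => simp only [map_add, Finset.sum_add_distrib, hp, hq]
  | mul_X p k hp =>
    simp only [Derivation.leibniz, Finset.sum_add_distrib, pderiv_X, Pi.single_apply, smul_eq_mul,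
      ← Finset.mul_sum, Finset.sum_ite_eq, Finset.mem_univ, if_true, map_add,
      map_mul, hp, Polynomial.derivative_mul]
    simp [diagonal]
    ring

lemma coeff_zero_diagonal (f : MvPolynomial ι ℂ) :
    (diagonal f).coeff 0 = constantCoeff f := by
  induction f using MvPolynomial.induction_on with
  | C r => simp [diagonal]
  | add p q hp hq => simp [hp, hq]
  | mul_X p k hp => simp [diagonal]

lemma diagonal_sum_dunkl_pow (c : ℂ) (s : ℕ) (f : MvPolynomial ι ℂ) :
    diagonal (((∑ j, dunkl c j) ^ s) f) = Polynomial.derivative^[s] (diagonal f) := by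
  induction s with
  | zero => simp
  | succ s ih =>
    rw [pow_succ', Module.End.mul_apply, sum_dunkl_apply, diagonal_sum_pderiv, ih,
      Function.iterate_succ_apply']

lemma sum_dunkl_pow_apply (c : ℂ) {i : ι} {g : MvPolynomial ι ℂ}
    (hg : ∀ j, j ≠ i → dunkl c j g = 0) (s : ℕ) :
    ((∑ j, dunkl c j) ^ s) g = (dunkl c i ^ s) g := by
  have h := dunklHom_apply_eq_aeval c hg ((∑ j, X j) ^ s)
  simpa [map_pow, map_sum, axis_X] using h

variable {a : ℕ}

lemma constantCoeff_dunkl_pow_masterQuot (ha : 1 ≤ a) (i : ι) (s : ℕ) :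
    constantCoeff ((dunkl (a : ℂ) i ^ s) (sumIntegral (masterQuot a i))) ≠ 0 ↔
      s = a * Fintype.card ι := by
  have : Nonempty ι := ⟨i⟩
  have hsymm : ∀ j : ι, constantCoeff ((dunkl (a : ℂ) j ^ s) (sumIntegral (masterQuot a j))) =
      constantCoeff ((dunkl (a : ℂ) i ^ s) (sumIntegral (masterQuot a i))) := by
    intro j
    rw [← constantCoeff_rename_perm (Equiv.swap i j)
      ((dunkl (a : ℂ) i ^ s) (sumIntegral (masterQuot a i)))]
    have := LinearMap.congr_fun (permEnd_mul_dunklHom (a : ℂ) (Equiv.swap i j) (X i ^ s))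
      (sumIntegral (masterQuot a i))
    simp only [Module.End.mul_apply, permEnd_apply, map_pow, rename_X, dunklHom_X,
      Equiv.swap_apply_left, rename_sumIntegral, map_masterQuot ha] at this
    rw [this]
  have hsum : (a : ℂ) * (Fintype.card ι *
      constantCoeff ((dunkl (a : ℂ) i ^ s) (sumIntegral (masterQuot a i)))) =
      - (Fintype.card ι * ((-1) ^ (a * Fintype.card ι) *
        (Polynomial.derivative^[s] (Polynomial.X ^ (a * Fintype.card ι) : Polynomial ℂ)).coeff 0)) := by
    have h := congrArg (fun F => (diagonal (((∑ j, dunkl (a : ℂ) j) ^ s) F)).coeff 0)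
      (sum_sumIntegral_masterQuot (ι := ι) ha)
    have h1 : diagonal (∏ m, (- X m : MvPolynomial ι ℂ) ^ a) =
        Polynomial.C ((-1) ^ (a * Fintype.card ι)) * Polynomial.X ^ (a * Fintype.card ι) := by
      simp only [diagonal, map_prod, map_pow, map_neg, aeval_X, Finset.prod_const, Finset.card_univ,
        ← pow_mul]
      rw [neg_pow (Polynomial.X : Polynomial ℂ)]
      simp
    simp only [map_sum, map_smul, map_neg] at h
    simp only [sum_dunkl_pow_apply (a : ℂ) fun j hj => dunkl_sumIntegral_masterQuot ha hj] at h
    rw [diagonal_sum_dunkl_pow, h1, Polynomial.iterate_derivative_C_mul] at h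
    simp only [Polynomial.finsetSum_coeff, Polynomial.coeff_smul, coeff_zero_diagonal, hsymm,
      Finset.sum_const, Finset.card_univ, Polynomial.coeff_neg, Polynomial.coeff_C_mul,
      smul_eq_mul, nsmul_eq_mul] at h
    linear_combination h
  have hc : (Fintype.card ι : ℂ) ≠ 0 := Nat.cast_ne_zero.mpr Fintype.card_ne_zero
  have ha' : (a : ℂ) ≠ 0 := Nat.cast_ne_zero.mpr (by omega)
  rw [Polynomial.coeff_iterate_derivative, zero_add, Polynomial.coeff_X_pow,
    Nat.descFactorial_self] at hsum
  constructor
  · intro h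
    by_contra hs
    rw [if_neg hs] at hsum
    simp [hc, ha', h] at hsum
  · intro hs h
    rw [h, if_pos hs] at hsum
    simp [hc, Nat.factorial_ne_zero] at hsum

lemma IsSingular.coeff_axis_eq_zero' (ha : 1 ≤ a) {f : MvPolynomial ι ℂ}
    (hf : IsSingular (a : ℂ) f) {N : ℕ} (hN : N ≠ 0) (i : ι) : (axis i f).coeff N = 0 := by
  by_cases hNa : N = a * Fintype.card ι
  · have h := pairing_symm (a : ℂ) f (sumIntegral (masterQuot a i))
    rw [hf.pairing_eq, constantCoeff_sumIntegral, zero_mul, pairing,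
      dunklHom_apply_eq_aeval _ fun j hj => dunkl_sumIntegral_masterQuot ha hj,
      Polynomial.aeval_eq_sum_range, LinearMap.sum_apply, map_sum] at h
    simp only [LinearMap.smul_apply, smul_eq_C_mul, map_mul, constantCoeff_C] at h
    by_cases hd : N ∈ Finset.range ((axis i f).natDegree + 1)
    · rw [Finset.sum_eq_single_of_mem N hd] at h
      · exact (mul_eq_zero.mp h).resolve_right
          ((constantCoeff_dunkl_pow_masterQuot ha i N).mpr hNa)
      · intro s _ hs
        rw [not_not.mp fun h => hs (((constantCoeff_dunkl_pow_masterQuot ha i s).mp h).trans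
          hNa.symm), mul_zero]
    · exact Polynomial.coeff_eq_zero_of_natDegree_lt (by simpa using hd)
  · exact hf.coeff_axis_eq_zero hN (by exact_mod_cast hNa) i

lemma finSuccEquiv_rename_swap_succ {p : ℕ} (j k : Fin p) (f : MvPolynomial (Fin (p + 1)) ℂ) :
    finSuccEquiv ℂ p (rename (Equiv.swap j.succ k.succ) f) =
      (finSuccEquiv ℂ p f).map
        (rename (Equiv.swap j k) : MvPolynomial (Fin p) ℂ →ₐ[ℂ] _).toRingHom := by
  induction f using MvPolynomial.induction_on with
  | C r => simp [finSuccEquiv_apply]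
  | add p q hp hq => simp [hp, hq]
  | mul_X q l hq =>
    rw [map_mul, map_mul, map_mul, Polynomial.map_mul, hq, rename_X]
    congrm _ * ?_
    refine Fin.cases ?_ (fun l => ?_) l
    · rw [Equiv.swap_apply_of_ne_of_ne (Fin.succ_ne_zero _).symm (Fin.succ_ne_zero _).symm]
      simp [finSuccEquiv_X_zero]
    · rw [← (Fin.succ_injective p).map_swap]
      simp [finSuccEquiv_X_succ]

lemma coeff_finSuccEquiv_pderiv {p : ℕ} (j : Fin p) (f : MvPolynomial (Fin (p + 1)) ℂ) (N : ℕ) :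
    (finSuccEquiv ℂ p (pderiv j.succ f)).coeff N = pderiv j ((finSuccEquiv ℂ p f).coeff N) := by
  have h : finSuccEquiv ℂ p (pderiv j.succ f) = coeffDeriv j (finSuccEquiv ℂ p f) := by
    induction f using MvPolynomial.induction_on with
    | C r => simp [finSuccEquiv_apply, ← Polynomial.monomial_zero_left, coeffDeriv_monomial]
    | add p q hp hq => simp [hp, hq]
    | mul_X q l hq =>
      have hl : finSuccEquiv ℂ p (pderiv j.succ (X l)) = coeffDeriv j (finSuccEquiv ℂ p (X l)) := by
        refine Fin.cases ?_ (fun l => ?_) l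
        · rw [finSuccEquiv_X_zero, pderiv_X_of_ne (Fin.succ_ne_zero _).symm,
            ← Polynomial.monomial_one_one_eq_X, coeffDeriv_monomial]
          simp
        · rw [finSuccEquiv_X_succ, ← Polynomial.monomial_zero_left, coeffDeriv_monomial]
          by_cases h : l = j
          · subst h; simp
          · rw [pderiv_X_of_ne h, pderiv_X_of_ne (by simpa using h)]; simp
      rw [Derivation.leibniz, map_mul, Derivation.leibniz, map_add, smul_eq_mul, smul_eq_mul,
        map_mul, map_mul, hq, hl, smul_eq_mul, smul_eq_mul]
  rw [h]; rfl

lemma coeff_finSuccEquiv_divDiff {p : ℕ} (j k : Fin p) (f : MvPolynomial (Fin (p + 1)) ℂ) (N : ℕ) :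
    (finSuccEquiv ℂ p (divDiff j.succ k.succ f)).coeff N =
      divDiff j k ((finSuccEquiv ℂ p f).coeff N) := by
  rcases eq_or_ne j k with rfl | h
  · simp
  · symm
    apply divDiff_eq_of_mul h
    have := congrArg (fun g => (finSuccEquiv ℂ p g).coeff N) (sub_mul_divDiff j.succ k.succ f)
    rw [map_mul, map_sub, finSuccEquiv_X_succ, finSuccEquiv_X_succ, ← Polynomial.C_sub,
      Polynomial.coeff_C_mul, map_sub, Polynomial.coeff_sub, finSuccEquiv_rename_swap_succ,
      Polynomial.coeff_map] at this
    exact this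

lemma coeff_finSuccEquiv_divDiff_zero {p : ℕ} (j : Fin p) (f : MvPolynomial (Fin (p + 1)) ℂ) {N : ℕ}
    (hN : ∀ i, degreeOf i f ≤ N) :
    (finSuccEquiv ℂ p (divDiff 0 j.succ f)).coeff N = 0 := by
  by_cases hg : finSuccEquiv ℂ p (divDiff 0 j.succ f) = 0
  · rw [hg, Polynomial.coeff_zero]
  apply Polynomial.coeff_eq_zero_of_natDegree_lt
  have h := congrArg (fun g => (finSuccEquiv ℂ p g).natDegree) (sub_mul_divDiff 0 j.succ f)
  have h1 : (finSuccEquiv ℂ p (f - rename (Equiv.swap 0 j.succ) f)).natDegree ≤ N := by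
    rw [map_sub]
    refine (Polynomial.natDegree_sub_le _ _).trans (max_le ?_ ?_)
    · rw [natDegree_finSuccEquiv]; exact hN 0
    · rw [natDegree_finSuccEquiv]
      have := degreeOf_rename_of_injective (p := f) (Equiv.swap 0 j.succ).injective j.succ
      rw [Equiv.swap_apply_right] at this
      rw [this]; exact hN _
  rw [map_mul, map_sub, finSuccEquiv_X_zero, finSuccEquiv_X_succ,
    Polynomial.natDegree_mul (Polynomial.X_sub_C_ne_zero _) hg,
    Polynomial.natDegree_X_sub_C] at h
  omega

lemma IsSingular.rename {c : ℂ} {f : MvPolynomial ι ℂ} (hf : IsSingular c f) (σ : Equiv.Perm ι) :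
    IsSingular c (rename σ f) := by
  intro i
  have := LinearMap.congr_fun (permEnd_mul_dunkl c σ (σ.symm i)) f
  rw [Equiv.apply_symm_apply] at this
  simp only [Module.End.mul_apply, permEnd_apply, hf (σ.symm i), map_zero] at this
  exact this.symm

lemma IsSingular.leadingCoeff {c : ℂ} {p N : ℕ} {f : MvPolynomial (Fin (p + 1)) ℂ}
    (hf : IsSingular c f) (hN : ∀ i, degreeOf i f ≤ N) :
    IsSingular c ((finSuccEquiv ℂ p f).coeff N) := by
  intro j
  have h := congrArg (fun g => (finSuccEquiv ℂ p g).coeff N) (hf j.succ)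
  simp only [dunkl_apply, map_sub, map_smul, map_sum, Fin.sum_univ_succ, map_add,
    Polynomial.coeff_sub, Polynomial.coeff_smul, Polynomial.coeff_add, Polynomial.finsetSum_coeff,
    divDiff_swap 0 (Fin.succ j), LinearMap.neg_apply, map_neg, Polynomial.coeff_neg, neg_zero,
    coeff_finSuccEquiv_divDiff_zero j f hN, coeff_finSuccEquiv_divDiff, coeff_finSuccEquiv_pderiv,
    zero_add, map_zero, Polynomial.coeff_zero] at h
  rw [dunkl_apply, h]

lemma axis_zero_eq {p : ℕ} (f : MvPolynomial (Fin (p + 1)) ℂ) :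
    axis 0 f = (finSuccEquiv ℂ p f).map constantCoeff := by
  induction f using MvPolynomial.induction_on with
  | C r => simp [finSuccEquiv_apply, axis]
  | add p q hp hq => simp [hp, hq]
  | mul_X q l hq =>
    rw [map_mul, map_mul, Polynomial.map_mul, hq]
    congr 1
    refine Fin.cases ?_ (fun l => ?_) l
    · simp [axis_X, finSuccEquiv_X_zero]
    · simp [axis_X, finSuccEquiv_X_succ]

/-- For a parameter that is a positive integer, only constants are killed by all Dunkl
operators. -/
theorem IsSingular.eq_C (ha : 1 ≤ a) : ∀ {p : ℕ} {f : MvPolynomial (Fin p) ℂ},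
    IsSingular (a : ℂ) f → f = C (constantCoeff f)
  | 0, f, _ => by
    obtain ⟨r, rfl⟩ := C_surjective (Fin 0) f
    simp
  | p + 1, f, hf => by
    obtain ⟨i, hi⟩ := Finite.exists_max fun i => degreeOf i f
    set g := MvPolynomial.rename (Equiv.swap i 0) f with hg
    have hgs : IsSingular (a : ℂ) g := hf.rename _
    have hgN : ∀ k, degreeOf k g ≤ degreeOf i f := fun k => by
      have := degreeOf_rename_of_injective (p := f) (Equiv.swap i 0).injective
        ((Equiv.swap i 0).symm k)
      rw [Equiv.apply_symm_apply] at this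
      rw [hg, this]; exact hi _
    have hg0 : degreeOf 0 g = degreeOf i f := by
      have := degreeOf_rename_of_injective (p := f) (Equiv.swap i 0).injective i
      rwa [Equiv.swap_apply_left] at this
    have hN : degreeOf i f = 0 := by
      by_contra hN
      have h1 := IsSingular.eq_C ha (hgs.leadingCoeff hgN)
      have h2 := hgs.coeff_axis_eq_zero' ha hN 0
      rw [axis_zero_eq, Polynomial.coeff_map] at h2
      rw [h2, C_0, ← hg0, ← natDegree_finSuccEquiv, Polynomial.coeff_natDegree,
        Polynomial.leadingCoeff_eq_zero] at h1
      rw [← hg0, ← natDegree_finSuccEquiv, h1] at hN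
      simp at hN
    ext m
    rw [coeff_C]
    split_ifs with hm
    · rw [← hm, constantCoeff_eq]
    · by_contra h
      apply hm
      ext k
      have := (monomial_le_degreeOf k (mem_support_iff.mpr h)).trans (hi k)
      simp; omega

lemma totalDegree_dunkl_lt (c : ℂ) (i : ι) {f : MvPolynomial ι ℂ} (h : dunkl c i f ≠ 0) :
    (dunkl c i f).totalDegree < f.totalDegree := by
  have h0 : 0 < f.totalDegree := by
    by_contra h0
    rw [totalDegree_eq_zero_iff_eq_C.mp (by omega : f.totalDegree = 0), dunkl_C] at h
    exact h rfl
  have h1 : (pderiv i f).totalDegree ≤ f.totalDegree - 1 := by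
    conv_lhs => rw [f.as_sum, map_sum]
    refine totalDegree_finsetSum_le fun m hm => ?_
    rw [pderiv_monomial]
    rcases Nat.eq_zero_or_pos (m i) with h | h
    · simp [h]
    refine (totalDegree_monomial_le _ _).trans ?_
    change (m - Finsupp.single i 1).sum (fun _ e => e) ≤ _
    have h2 := le_totalDegree hm
    have h3 : m = (m - Finsupp.single i 1) + Finsupp.single i 1 := by
      rw [tsub_add_cancel_of_le (Finsupp.single_le_iff.mpr h)]
    rw [h3, Finsupp.sum_add_index' (by simp) (by simp), Finsupp.sum_single_index rfl] at h2
    omega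
  have h2 : ∀ j, (divDiff i j f).totalDegree ≤ f.totalDegree - 1 := fun j => by
    by_cases hg : divDiff i j f = 0
    · simp [hg]
    have hij : i ≠ j := by rintro rfl; simp at hg
    have h3 := congrArg totalDegree (sub_mul_divDiff i j f)
    have h4 : (X i - X j : MvPolynomial ι ℂ).totalDegree ≠ 0 := fun h4 => by
      have := congrArg (pderiv i) (totalDegree_eq_zero_iff_eq_C.mp h4)
      rw [map_sub, pderiv_X_self, pderiv_X_of_ne hij.symm, pderiv_C] at this
      simp at this
    rw [totalDegree_mul_of_isDomain (X_sub_X_ne_zero hij) hg] at h3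
    have h5 := (totalDegree_sub f (MvPolynomial.rename (Equiv.swap i j) f)).trans
      (max_le le_rfl (totalDegree_rename_le _ f))
    omega
  rw [dunkl_apply]
  have h6 : (pderiv i f - c • ∑ j, divDiff i j f).totalDegree ≤ f.totalDegree - 1 :=
    (totalDegree_sub _ _).trans (max_le h1 ((totalDegree_smul_le _ _).trans
      (totalDegree_finsetSum_le fun j _ => h2 j)))
  omega

/-- The contravariant pairing is nondegenerate. -/
theorem eq_zero_of_pairing_eq_zero (ha : 1 ≤ a) {p : ℕ} {f : MvPolynomial (Fin p) ℂ}
    (hf : ∀ P, pairing (a : ℂ) P f = 0) : f = 0 := by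
  induction hd : f.totalDegree using Nat.strong_induction_on generalizing f with
  | _ d ih =>
    have h : IsSingular (a : ℂ) f := fun i => by
      by_contra h
      refine h (ih _ (hd ▸ totalDegree_dunkl_lt _ i h) (fun P => ?_) rfl)
      have := hf (P * X i)
      rwa [pairing, map_mul, dunklHom_X] at this
    have h1 := hf 1
    rw [h.pairing_eq] at h1
    rw [h.eq_C ha, show constantCoeff f = 0 by simpa using h1, C_0]

end SingularConst

section Kernel

open scoped TensorProduct
open Algebra.TensorProduct (includeLeft includeRight)

variable (ι κ : Type*) [DecidableEq ι] [DecidableEq κ] [Fintype ι] [Fintype κ]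

/-- Polynomials in two families of variables. -/
abbrev TwoPoly := MvPolynomial ι ℂ ⊗[ℂ] MvPolynomial κ ℂ

variable {ι κ}

instance : IsDomain (TwoPoly ι κ) :=
  (algebraTensorAlgEquiv ℂ (MvPolynomial ι ℂ) (σ := κ)).toMulEquiv.isDomain _

/-- The sum of a variable of the first family and a variable of the second one. -/
noncomputable def linForm (q : ι × κ) : TwoPoly ι κ := X q.1 ⊗ₜ 1 + 1 ⊗ₜ X q.2

variable (ι κ) in
/-- The product of the `a`-th powers of all `linForm`s. -/
noncomputable def kernel (a : ℕ) : TwoPoly ι κ := ∏ q, linForm q ^ a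

/-- The quotient of `kernel` by one of its linear factors. -/
noncomputable def kernelQuot (a : ℕ) (q : ι × κ) : TwoPoly ι κ :=
  linForm q ^ (a - 1) * ∏ r ∈ Finset.univ.erase q, linForm r ^ a

lemma linForm_mul_kernelQuot {a : ℕ} (ha : 1 ≤ a) (q : ι × κ) :
    linForm q * kernelQuot a q = kernel ι κ a := by
  rw [kernelQuot, ← mul_assoc, mul_pow_sub_one (by omega), kernel,
    ← Finset.mul_prod_erase _ _ (Finset.mem_univ q)]

lemma linForm_ne_zero (q : ι × κ) : linForm q ≠ 0 := fun h => by
  have := congrArg (Algebra.TensorProduct.productMap (aeval fun _ => (1 : ℂ))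
    (aeval fun _ => (0 : ℂ))) h
  simp [linForm] at this

/-- The first partial derivatives, extended to polynomials in two families of variables. -/
noncomputable def leftDeriv (i : ι) : Derivation ℂ (TwoPoly ι κ) (TwoPoly ι κ) :=
  Derivation.mk' ((pderiv i).toLinearMap.rTensor (MvPolynomial κ ℂ)) fun f g => by
    induction f using TensorProduct.induction_on with
    | zero => simp
    | add f₁ f₂ h₁ h₂ =>
      rw [add_mul, map_add, h₁, h₂, map_add, add_smul, smul_add]; abel
    | tmul p q =>
      induction g using TensorProduct.induction_on with
      | zero => simp
      | add g₁ g₂ h₁ h₂ =>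
        rw [mul_add, map_add, h₁, h₂, map_add, add_smul, smul_add]; abel
      | tmul r s =>
        simp only [Algebra.TensorProduct.tmul_mul_tmul, LinearMap.rTensor_tmul, smul_eq_mul,
          Derivation.coeFn_coe, Derivation.leibniz, TensorProduct.add_tmul, mul_comm q s]

lemma leftDeriv_tmul (i : ι) (f : MvPolynomial ι ℂ) (g : MvPolynomial κ ℂ) :
    leftDeriv i (f ⊗ₜ g) = pderiv i f ⊗ₜ[ℂ] g := rfl

lemma leftDeriv_apply (i : ι) (f : TwoPoly ι κ) :
    leftDeriv i f = (pderiv i).toLinearMap.rTensor (MvPolynomial κ ℂ) f := rfl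

lemma leftDeriv_linForm (i : ι) (q : ι × κ) :
    leftDeriv i (linForm q) = if q.1 = i then 1 else 0 := by
  rw [linForm, map_add, leftDeriv_tmul, leftDeriv_tmul, pderiv_one, TensorProduct.zero_tmul,
    add_zero]
  split_ifs with h
  · rw [h, pderiv_X_self]; rfl
  · rw [pderiv_X_of_ne h, TensorProduct.zero_tmul]

lemma _root_.Derivation.prod_apply {A : Type*} [CommRing A] [Algebra ℂ A] (D : Derivation ℂ A A)
    {σ : Type*} [DecidableEq σ] (s : Finset σ) (f : σ → A) :
    D (∏ q ∈ s, f q) = ∑ q ∈ s, (∏ r ∈ s.erase q, f r) * D (f q) := by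
  induction s using Finset.induction_on with
  | empty => simp
  | insert q s hq ih =>
    rw [Finset.prod_insert hq, Derivation.leibniz, ih, Finset.sum_insert hq,
      Finset.erase_insert hq, smul_eq_mul, smul_eq_mul, add_comm, Finset.mul_sum]
    congr 1
    refine Finset.sum_congr rfl fun r hr => ?_
    have h : q ≠ r := fun h => hq (h ▸ hr)
    rw [Finset.erase_insert_of_ne h, Finset.prod_insert (by simp [hq]), mul_assoc]

lemma leftDeriv_kernel (a : ℕ) (i : ι) :
    leftDeriv i (kernel ι κ a) = (a : ℂ) • ∑ j, kernelQuot a (i, j) := by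
  rw [kernel, Derivation.prod_apply, Fintype.sum_prod_type, Finset.sum_eq_single i, Finset.smul_sum]
  · refine Finset.sum_congr rfl fun j _ => ?_
    rw [Derivation.leibniz_pow, leftDeriv_linForm, if_pos rfl, kernelQuot, smul_eq_mul, mul_one,
      Nat.cast_smul_eq_nsmul, mul_comm, smul_mul_assoc]
  · intro k _ hk
    refine Finset.sum_eq_zero fun j _ => ?_
    rw [Derivation.leibniz_pow, leftDeriv_linForm, if_neg hk]
    simp
  · simp

/-- A permutation of the first family of variables. -/
noncomputable def leftPerm (σ : Equiv.Perm ι) : TwoPoly ι κ →ₐ[ℂ] TwoPoly ι κ :=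
  Algebra.TensorProduct.map (rename σ) (AlgHom.id ℂ _)

lemma rTensor_permEnd (σ : Equiv.Perm ι) (f : TwoPoly ι κ) :
    (permEnd σ).rTensor (MvPolynomial κ ℂ) f = leftPerm σ f := rfl

lemma leftPerm_linForm (σ : Equiv.Perm ι) (q : ι × κ) :
    leftPerm σ (linForm q) = linForm (σ q.1, q.2) := by
  simp [leftPerm, linForm]

lemma leftPerm_kernel (a : ℕ) (σ : Equiv.Perm ι) : leftPerm σ (kernel ι κ a) = kernel ι κ a := by
  simp only [kernel, map_prod, map_pow, leftPerm_linForm]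
  exact Fintype.prod_equiv (σ.prodCongr (Equiv.refl κ)) _ _ fun _ => rfl

lemma leftPerm_kernelQuot {a : ℕ} (ha : 1 ≤ a) (σ : Equiv.Perm ι) (q : ι × κ) :
    leftPerm σ (kernelQuot a q) = kernelQuot a (σ q.1, q.2) := by
  apply mul_left_cancel₀ (linForm_ne_zero (σ q.1, q.2))
  rw [linForm_mul_kernelQuot ha, ← leftPerm_linForm, ← map_mul, linForm_mul_kernelQuot ha,
    leftPerm_kernel]

lemma rTensor_xEnd (i : ι) (f : TwoPoly ι κ) :
    (xEnd i).rTensor (MvPolynomial κ ℂ) f = X i ⊗ₜ 1 * f := by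
  induction f using TensorProduct.induction_on with
  | zero => simp
  | add f g hf hg => rw [map_add, hf, hg, mul_add]
  | tmul p q => simp

lemma rTensor_divDiff_kernel (a : ℕ) (i j : ι) :
    (divDiff i j).rTensor (MvPolynomial κ ℂ) (kernel ι κ a) = 0 := by
  rcases eq_or_ne i j with rfl | h
  · simp
  have h1 : (xEnd i - xEnd j) * divDiff i j = 1 - permEnd (Equiv.swap i j) :=
    LinearMap.ext fun f => by
      simpa [sub_mul] using sub_mul_divDiff i j f
  have h2 := congrArg (fun F => F.rTensor (MvPolynomial κ ℂ) (kernel ι κ a)) h1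
  rw [LinearMap.rTensor_mul, LinearMap.rTensor_sub, LinearMap.rTensor_sub, LinearMap.sub_apply,
    rTensor_permEnd, leftPerm_kernel, Module.End.mul_apply, LinearMap.sub_apply, rTensor_xEnd,
    rTensor_xEnd, ← sub_mul, ← TensorProduct.sub_tmul] at h2
  have h3 : (1 : Module.End ℂ (MvPolynomial ι ℂ)).rTensor (MvPolynomial κ ℂ) (kernel ι κ a) =
    kernel ι κ a := by simp [Module.End.one_eq_id]
  rw [h3, sub_self] at h2
  refine (mul_eq_zero.mp h2).resolve_left fun h4 => X_sub_X_ne_zero h ?_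
  exact Algebra.TensorProduct.includeLeft_injective (S := ℂ) (algebraMap ℂ _).injective
    (h4.trans (map_zero includeLeft).symm)

lemma rTensor_dunkl_apply (c : ℂ) (i : ι) (f : TwoPoly ι κ) :
    (dunkl c i).rTensor (MvPolynomial κ ℂ) f =
      leftDeriv i f - c • ∑ j, (divDiff i j).rTensor (MvPolynomial κ ℂ) f := by
  have h : dunkl c i = (pderiv i).toLinearMap - c • ∑ j, divDiff i j :=
    LinearMap.ext fun f => by simp [dunkl_apply]
  rw [h, LinearMap.rTensor_sub, LinearMap.rTensor_smul, LinearMap.sub_apply, leftDeriv_apply,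
    LinearMap.smul_apply]
  congr 2
  induction f using TensorProduct.induction_on with
  | zero => simp
  | add f g hf hg => simp only [map_add, hf, hg, Finset.sum_add_distrib]
  | tmul p q => simp [TensorProduct.sum_tmul]

lemma rTensor_dunkl_kernel (a : ℕ) (i : ι) :
    (dunkl (a : ℂ) i).rTensor (MvPolynomial κ ℂ) (kernel ι κ a) =
      (a : ℂ) • ∑ j, kernelQuot a (i, j) := by
  rw [rTensor_dunkl_apply, leftDeriv_kernel]
  simp [rTensor_divDiff_kernel]

lemma rTensor_dunkl_X_mul (c : ℂ) (i : ι) (f : TwoPoly ι κ) :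
    (dunkl c i).rTensor (MvPolynomial κ ℂ) (X i ⊗ₜ 1 * f) =
      X i ⊗ₜ 1 * (dunkl c i).rTensor (MvPolynomial κ ℂ) f + f -
        c • ∑ j, leftPerm (Equiv.swap i j) f + c • f := by
  induction f using TensorProduct.induction_on with
  | zero => simp
  | add f g hf hg =>
    simp only [mul_add, map_add, hf, hg, Finset.sum_add_distrib, smul_add]; abel
  | tmul p q =>
    have h := LinearMap.congr_fun (dunkl_mul_xEnd c i i) p
    simp only [Module.End.mul_apply, xEnd_apply, if_pos, LinearMap.add_apply, LinearMap.sub_apply,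
      LinearMap.smul_apply, Module.End.one_apply, LinearMap.sum_apply, permEnd_apply,
      Equiv.swap_self, rename_id_apply, Equiv.coe_refl] at h
    simp only [Algebra.TensorProduct.tmul_mul_tmul, LinearMap.rTensor_tmul, one_mul, h, leftPerm,
      Algebra.TensorProduct.map_tmul, AlgHom.id_apply, TensorProduct.add_tmul,
      TensorProduct.sub_tmul, ← TensorProduct.smul_tmul', TensorProduct.sum_tmul]
    abel

lemma rTensor_dunkl_one_tmul_mul (c : ℂ) (i : ι) (g : MvPolynomial κ ℂ) (f : TwoPoly ι κ) :
    (dunkl c i).rTensor (MvPolynomial κ ℂ) (1 ⊗ₜ g * f) =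
      1 ⊗ₜ g * (dunkl c i).rTensor (MvPolynomial κ ℂ) f := by
  induction f using TensorProduct.induction_on with
  | zero => simp
  | add f g hf hg => simp only [mul_add, map_add, hf, hg]
  | tmul p q => simp

lemma linForm_mul_rTensor_dunkl_kernelQuot {a : ℕ} (ha : 1 ≤ a) (i : ι) (j : κ) :
    linForm (i, j) * (dunkl (a : ℂ) i).rTensor (MvPolynomial κ ℂ) (kernelQuot a (i, j)) =
      (a : ℂ) • ∑ l, kernelQuot a (i, l) + (a : ℂ) • ∑ k, kernelQuot a (k, j) -
        (a + 1 : ℂ) • kernelQuot a (i, j) := by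
  have h := rTensor_dunkl_kernel (κ := κ) a i
  rw [← linForm_mul_kernelQuot ha (i, j)] at h
  nth_rw 1 [linForm] at h
  rw [add_mul, map_add, rTensor_dunkl_X_mul, rTensor_dunkl_one_tmul_mul] at h
  simp only [leftPerm_kernelQuot ha, Equiv.swap_apply_left] at h
  rw [← h, linForm, add_mul, add_smul, one_smul]
  abel

end Kernel

section Intertwine

open scoped TensorProduct

variable {ι κ : Type*} [DecidableEq ι] [DecidableEq κ] [Fintype ι] [Fintype κ]

lemma comm_linForm (q : ι × κ) :
    Algebra.TensorProduct.comm ℂ _ _ (linForm q) = linForm q.swap := by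
  simp [linForm, add_comm]

lemma comm_kernel (a : ℕ) :
    Algebra.TensorProduct.comm ℂ _ _ (kernel ι κ a) = kernel κ ι a := by
  simp only [kernel, map_prod, map_pow, comm_linForm]
  exact Fintype.prod_equiv (Equiv.prodComm ι κ) _ _ fun _ => rfl

lemma comm_kernelQuot {a : ℕ} (ha : 1 ≤ a) (q : ι × κ) :
    Algebra.TensorProduct.comm ℂ _ _ (kernelQuot a q) = kernelQuot a q.swap := by
  apply mul_left_cancel₀ (linForm_ne_zero q.swap)
  rw [linForm_mul_kernelQuot ha, ← comm_linForm, ← map_mul, linForm_mul_kernelQuot ha, comm_kernel]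

lemma comm_lTensor (F : Module.End ℂ (MvPolynomial κ ℂ)) (f : TwoPoly ι κ) :
    Algebra.TensorProduct.comm ℂ _ _ (F.lTensor (MvPolynomial ι ℂ) f) =
      F.rTensor (MvPolynomial ι ℂ) (Algebra.TensorProduct.comm ℂ _ _ f) := by
  induction f using TensorProduct.induction_on with
  | zero => simp
  | add f g hf hg => simp only [map_add, hf, hg]
  | tmul p q => simp

lemma rTensor_dunkl_kernelQuot {a : ℕ} (ha : 1 ≤ a) (i : ι) (j : κ) :
    (dunkl (a : ℂ) i).rTensor (MvPolynomial κ ℂ) (kernelQuot a (i, j)) =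
      (dunkl (a : ℂ) j).lTensor (MvPolynomial ι ℂ) (kernelQuot a (i, j)) := by
  apply mul_left_cancel₀ (linForm_ne_zero (i, j))
  rw [linForm_mul_rTensor_dunkl_kernelQuot ha]
  apply (Algebra.TensorProduct.comm ℂ _ _).injective
  rw [map_mul, comm_lTensor, comm_linForm, comm_kernelQuot ha, Prod.swap_prod_mk,
    linForm_mul_rTensor_dunkl_kernelQuot ha]
  simp only [map_sub, map_add, map_smul, map_sum, comm_kernelQuot ha, Prod.swap_prod_mk]
  abel

lemma lTensor_dunkl_kernel (a : ℕ) (ha : 1 ≤ a) (j : κ) :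
    (dunkl (a : ℂ) j).lTensor (MvPolynomial ι ℂ) (kernel ι κ a) =
      (a : ℂ) • ∑ i, kernelQuot a (i, j) := by
  apply (Algebra.TensorProduct.comm ℂ _ _).injective
  rw [comm_lTensor, comm_kernel, rTensor_dunkl_kernel]
  simp only [map_smul, map_sum, comm_kernelQuot ha, Prod.swap_prod_mk]

lemma rTensor_lTensor_comm (F : Module.End ℂ (MvPolynomial ι ℂ))
    (G : Module.End ℂ (MvPolynomial κ ℂ)) (f : TwoPoly ι κ) :
    F.rTensor _ (G.lTensor _ f) = G.lTensor _ (F.rTensor _ f) := by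
  rw [← LinearMap.comp_apply, ← LinearMap.comp_apply, LinearMap.rTensor_comp_lTensor,
    LinearMap.lTensor_comp_rTensor]

lemma rTensor_dunkl_pow_kernelQuot {a : ℕ} (ha : 1 ≤ a) (i : ι) (j : κ) (n : ℕ) :
    (dunkl (a : ℂ) i ^ n).rTensor (MvPolynomial κ ℂ) (kernelQuot a (i, j)) =
      (dunkl (a : ℂ) j ^ n).lTensor (MvPolynomial ι ℂ) (kernelQuot a (i, j)) := by
  induction n with
  | zero => simp [Module.End.one_eq_id]
  | succ n ih =>
    rw [pow_succ, LinearMap.rTensor_mul, Module.End.mul_apply, rTensor_dunkl_kernelQuot ha,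
      rTensor_lTensor_comm, ih, pow_succ', LinearMap.lTensor_mul, Module.End.mul_apply]

variable (ι κ) in
/-- Two polynomials whose Dunkl operators agree on the kernel. -/
def Intertwined (a : ℕ) (P : MvPolynomial ι ℂ) (Q : MvPolynomial κ ℂ) : Prop :=
  (dunklHom (a : ℂ) P).rTensor (MvPolynomial κ ℂ) (kernel ι κ a) =
    (dunklHom (a : ℂ) Q).lTensor (MvPolynomial ι ℂ) (kernel ι κ a)

variable {a : ℕ}

lemma Intertwined.add {P P' : MvPolynomial ι ℂ} {Q Q' : MvPolynomial κ ℂ}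
    (h : Intertwined ι κ a P Q) (h' : Intertwined ι κ a P' Q') :
    Intertwined ι κ a (P + P') (Q + Q') := by
  unfold Intertwined at *
  simp only [map_add, LinearMap.rTensor_add, LinearMap.lTensor_add, LinearMap.add_apply, h, h']

lemma Intertwined.mul {P P' : MvPolynomial ι ℂ} {Q Q' : MvPolynomial κ ℂ}
    (h : Intertwined ι κ a P Q) (h' : Intertwined ι κ a P' Q') :
    Intertwined ι κ a (P * P') (Q * Q') := by
  unfold Intertwined at *
  rw [map_mul, LinearMap.rTensor_mul, Module.End.mul_apply, h', rTensor_lTensor_comm, h,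
    mul_comm Q, map_mul, LinearMap.lTensor_mul, Module.End.mul_apply]

lemma intertwined_C (r : ℂ) : Intertwined ι κ a (C r) (C r) := by
  rw [Intertwined, dunklHom_C, dunklHom_C]
  simp [Module.End.one_eq_id]

lemma intertwined_sum {σ : Type*} (s : Finset σ) {P : σ → MvPolynomial ι ℂ}
    {Q : σ → MvPolynomial κ ℂ} (h : ∀ i ∈ s, Intertwined ι κ a (P i) (Q i)) :
    Intertwined ι κ a (∑ i ∈ s, P i) (∑ i ∈ s, Q i) := by
  classical
  induction s using Finset.induction_on with
  | empty => simpa using intertwined_C (a := a) (ι := ι) (κ := κ) 0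
  | insert i s hi ih =>
    rw [Finset.sum_insert hi, Finset.sum_insert hi]
    exact (h i (by simp)).add (ih fun j hj => h j (by simp [hj]))

lemma intertwined_psum (ha : 1 ≤ a) {r : ℕ} (hr : r ≠ 0) :
    Intertwined ι κ a (psum ι ℂ r) (psum κ ℂ r) := by
  obtain ⟨n, rfl⟩ := Nat.exists_eq_succ_of_ne_zero hr
  have hl : ∀ i : ι, (dunkl (a : ℂ) i ^ (n + 1)).rTensor (MvPolynomial κ ℂ) (kernel ι κ a) =
      (a : ℂ) • ∑ j : κ,
        (dunkl (a : ℂ) i ^ n).rTensor (MvPolynomial κ ℂ) (kernelQuot a (i, j)) := fun i => by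
    rw [pow_succ, LinearMap.rTensor_mul, Module.End.mul_apply, rTensor_dunkl_kernel, map_smul,
      map_sum]
  have hr : ∀ j : κ, (dunkl (a : ℂ) j ^ (n + 1)).lTensor (MvPolynomial ι ℂ) (kernel ι κ a) =
      (a : ℂ) • ∑ i : ι,
        (dunkl (a : ℂ) j ^ n).lTensor (MvPolynomial ι ℂ) (kernelQuot a (i, j)) := fun j => by
    rw [pow_succ, LinearMap.lTensor_mul, Module.End.mul_apply, lTensor_dunkl_kernel a ha, map_smul,
      map_sum]
  have hL : (dunklHom (a : ℂ) (psum ι ℂ (n + 1))).rTensor (MvPolynomial κ ℂ) (kernel ι κ a) =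
      ∑ i, (dunkl (a : ℂ) i ^ (n + 1)).rTensor (MvPolynomial κ ℂ) (kernel ι κ a) := by
    have h := map_sum (Module.End.rTensorAlgHom ℂ (MvPolynomial ι ℂ) (MvPolynomial κ ℂ))
      (fun i => dunkl (a : ℂ) i ^ (n + 1)) Finset.univ
    have h2 := LinearMap.congr_fun h (kernel ι κ a)
    rw [LinearMap.sum_apply] at h2
    simp only [psum, map_sum, map_pow, dunklHom_X]
    exact h2
  have hR : (dunklHom (a : ℂ) (psum κ ℂ (n + 1))).lTensor (MvPolynomial ι ℂ) (kernel ι κ a) =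
      ∑ j, (dunkl (a : ℂ) j ^ (n + 1)).lTensor (MvPolynomial ι ℂ) (kernel ι κ a) := by
    have h := map_sum (Module.End.lTensorAlgHom ℂ (MvPolynomial κ ℂ) (MvPolynomial ι ℂ))
      (fun i => dunkl (a : ℂ) i ^ (n + 1)) Finset.univ
    have h2 := LinearMap.congr_fun h (kernel ι κ a)
    rw [LinearMap.sum_apply] at h2
    simp only [psum, map_sum, map_pow, dunklHom_X]
    exact h2
  unfold Intertwined
  rw [hL, hR]
  simp only [hl, hr, rTensor_dunkl_pow_kernelQuot ha]
  rw [← Finset.smul_sum, ← Finset.smul_sum, Finset.sum_comm]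

/-- Newton's identity, solved for the elementary symmetric polynomial. -/
lemma esymm_eq_sum (σ : Type*) [Fintype σ] {n : ℕ} (hn : 0 < n) :
    esymm σ ℂ n = C ((n : ℂ)⁻¹ * (-1) ^ (n + 1)) *
      ∑ x ∈ Finset.HasAntidiagonal.antidiagonal n with x.1 < n,
        C ((-1) ^ x.1) * esymm σ ℂ x.1 * psum σ ℂ x.2 := by
  have h := mul_esymm_eq_sum σ ℂ n
  have hn' : (n : ℂ) ≠ 0 := Nat.cast_ne_zero.mpr hn.ne'
  have h2 := congrArg (C ((n : ℂ)⁻¹) * ·) h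
  rw [← map_natCast (C : ℂ →+* MvPolynomial σ ℂ), ← mul_assoc, ← C_mul, inv_mul_cancel₀ hn',
    C_1, one_mul] at h2
  rw [h2, C_mul, mul_assoc]
  simp

lemma intertwined_esymm (ha : 1 ≤ a) (n : ℕ) :
    Intertwined ι κ a (esymm ι ℂ n) (esymm κ ℂ n) := by
  induction n using Nat.strong_induction_on with
  | _ n ih =>
    rcases Nat.eq_zero_or_pos n with rfl | hn
    · simpa using intertwined_C (a := a) (ι := ι) (κ := κ) 1
    rw [esymm_eq_sum ι hn, esymm_eq_sum κ hn]
    refine (intertwined_C _).mul (intertwined_sum _ fun x hx => ?_)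
    rw [Finset.mem_filter, Finset.HasAntidiagonal.mem_antidiagonal] at hx
    exact ((intertwined_C _).mul (ih _ hx.2)).mul (intertwined_psum ha (by omega))

/-- Every symmetric polynomial of one family of variables is intertwined with a symmetric
polynomial of the other one. -/
lemma exists_intertwined (ha : 1 ≤ a) {Q : MvPolynomial κ ℂ} (hQ : Q.IsSymmetric) :
    ∃ P : MvPolynomial ι ℂ, P.IsSymmetric ∧ Intertwined ι κ a P Q := by
  obtain ⟨F, hF⟩ := esymmAlgHom_surjective (σ := κ) ℂ le_rfl ⟨Q, hQ⟩
  have h := congrArg Subtype.val hF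
  refine ⟨esymmAlgHom ι ℂ (Fintype.card κ) F, (esymmAlgHom ι ℂ _ F).2, ?_⟩
  change _ = Q at h
  rw [← h]
  clear h hF
  induction F using MvPolynomial.induction_on with
  | C r => simpa [esymmAlgHom, algebraMap_eq] using intertwined_C (a := a) (ι := ι) (κ := κ) r
  | add p q hp hq => simpa using hp.add hq
  | mul_X p i hp =>
    simp only [map_mul, esymmAlgHom, aeval_X]
    exact hp.mul (intertwined_esymm ha _)

end Intertwine

section LinearAlgebra

open scoped TensorProduct
open Module

variable {F A B : Type*} [Field F] [AddCommGroup A] [AddCommGroup B] [Module F A] [Module F B]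

/-- Contraction of a tensor against functionals on its second factor. -/
noncomputable def contraction : A ⊗[F] B →ₗ[F] Dual F B →ₗ[F] A :=
  TensorProduct.lift <| LinearMap.mk₂ F
    (fun p q => ((LinearMap.applyₗ q : Dual F B →ₗ[F] F)).smulRight p)
    (fun _ _ _ => by ext; simp) (fun _ _ _ => by ext; exact smul_comm _ _ _)
    (fun _ _ _ => by ext; simp [add_smul]) (fun _ _ _ => by ext; simp [mul_smul])

@[simp] lemma contraction_tmul (p : A) (q : B) (θ : Dual F B) :
    contraction (p ⊗ₜ[F] q) θ = θ q • p := rfl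

lemma contraction_rTensor (f : End F A) (K : A ⊗[F] B) (θ : Dual F B) :
    contraction (f.rTensor B K) θ = f (contraction K θ) := by
  induction K using TensorProduct.induction_on with
  | zero => simp
  | add K L hK hL => simp only [map_add, LinearMap.add_apply, hK, hL]
  | tmul p q => simp

lemma contraction_lTensor (g : End F B) (K : A ⊗[F] B) (θ : Dual F B) :
    contraction (g.lTensor A K) θ = contraction K (θ ∘ₗ g) := by
  induction K using TensorProduct.induction_on with
  | zero => simp
  | add K L hK hL => simp only [map_add, LinearMap.add_apply, hK, hL]
  | tmul p q => simp

lemma apply_contraction (K : A ⊗[F] B) (θ : Dual F B) (l : Dual F A) :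
    l (contraction K θ) = θ (contraction (TensorProduct.comm F A B K) l) := by
  induction K using TensorProduct.induction_on with
  | zero => simp
  | add K L hK hL => simp only [map_add, LinearMap.add_apply, hK, hL]
  | tmul p q => simp [mul_comm]

instance (K : A ⊗[F] B) : FiniteDimensional F (LinearMap.range (contraction K)) := by
  suffices h : ∃ V : Submodule F A, FiniteDimensional F V ∧ ∀ θ, contraction K θ ∈ V by
    obtain ⟨V, hV, h⟩ := h
    exact Submodule.finiteDimensional_of_le (S₂ := V) (by rintro _ ⟨θ, rfl⟩; exact h θ)
  induction K using TensorProduct.induction_on with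
  | zero => exact ⟨⊥, inferInstance, by simp⟩
  | add K L hK hL =>
    obtain ⟨V, hV, hK⟩ := hK
    obtain ⟨V', hV', hL⟩ := hL
    refine ⟨V ⊔ V', inferInstance, fun θ => ?_⟩
    rw [map_add, LinearMap.add_apply]
    exact Submodule.add_mem_sup (hK θ) (hL θ)
  | tmul p q =>
    exact ⟨F ∙ p, inferInstance, fun θ => Submodule.smul_mem _ _ (Submodule.mem_span_singleton_self p)⟩

lemma finrank_range_contraction_comm_le (K : A ⊗[F] B) :
    finrank F (LinearMap.range (contraction (TensorProduct.comm F A B K))) ≤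
      finrank F (LinearMap.range (contraction K)) := by
  set W := LinearMap.range (contraction K)
  obtain ⟨s, hs⟩ := LinearMap.exists_rightInverse_of_surjective (W.dualRestrict)
    (LinearMap.range_eq_top.mpr Subspace.dualRestrict_surjective)
  have h : LinearMap.range (contraction (TensorProduct.comm F A B K)) ≤
      LinearMap.range (contraction (TensorProduct.comm F A B K) ∘ₗ s) := by
    rintro _ ⟨l, rfl⟩
    refine ⟨W.dualRestrict l, ?_⟩
    rw [LinearMap.comp_apply, ← sub_eq_zero, ← map_sub,
      ← Module.forall_dual_apply_eq_zero_iff F]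
    intro θ
    rw [← apply_contraction, LinearMap.sub_apply, sub_eq_zero]
    exact LinearMap.congr_fun (LinearMap.congr_fun hs (W.dualRestrict l))
      ⟨contraction K θ, LinearMap.mem_range_self _ θ⟩
  calc _ ≤ _ := Submodule.finrank_mono h
    _ ≤ finrank F (Dual F W) := LinearMap.finrank_range_le _
    _ = _ := Subspace.dual_finrank_eq

lemma range_contraction_le {K : A ⊗[F] B} {U : Submodule F A}
    (h : ∀ l : Dual F A, (∀ u ∈ U, l u = 0) → contraction (TensorProduct.comm F A B K) l = 0) :
    LinearMap.range (contraction K) ≤ U := by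
  rintro _ ⟨θ, rfl⟩
  by_contra hx
  obtain ⟨l, hl, hU⟩ := Submodule.exists_le_ker_of_notMem hx
  refine hl ?_
  rw [apply_contraction, h l fun u hu => hU hu, map_zero]

lemma mul_finrank_le_of_le_ker {E : End F A} {U : Submodule F A} (hU : U ≤ LinearMap.ker E) (n : ℕ)
    {W : Submodule F A} [FiniteDimensional F W] (hW : W.map E ≤ W) (hUW : U ≤ W.map (E ^ n)) :
    (n + 1) * finrank F U ≤ finrank F W := by
  induction n generalizing W with
  | zero =>
    rw [pow_zero, Module.End.one_eq_id, Submodule.map_id] at hUW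
    simpa using Submodule.finrank_mono hUW
  | succ n ih =>
    have hpow : ∀ n, W.map (E ^ n) ≤ W := fun n => by
      induction n with
      | zero => rw [pow_zero, Module.End.one_eq_id, Submodule.map_id]
      | succ n ih =>
        rw [pow_succ', Module.End.mul_eq_comp, Submodule.map_comp]
        exact (Submodule.map_mono ih).trans hW
    have h1 := ih (W := W.map E) (Submodule.map_mono hW) (by
      rwa [← Submodule.map_comp, ← Module.End.mul_eq_comp, ← pow_succ])
    have h2 := (E.domRestrict W).finrank_range_add_finrank_ker
    rw [LinearMap.range_domRestrict] at h2
    have h3 : finrank F U ≤ finrank F (LinearMap.ker (E.domRestrict W)) := by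
      have hUW' : U ≤ W := hUW.trans (hpow _)
      rw [← LinearMap.finrank_range_of_inj (Submodule.inclusion_injective hUW')]
      refine Submodule.finrank_mono ?_
      rintro _ ⟨u, rfl⟩
      exact hU u.2
    have h4 : (n + 1 + 1) * finrank F U = (n + 1) * finrank F U + finrank F U := by ring
    omega

end LinearAlgebra

section Staircase

variable {ι : Type*} [DecidableEq ι] [Fintype ι]

lemma rename_swap_prod_X (i j : ι) (s : Finset ι) (h : i ∈ s ↔ j ∈ s) :
    rename (Equiv.swap i j) (∏ l ∈ s, (X l : MvPolynomial ι ℂ)) = ∏ l ∈ s, X l := by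
  simp only [map_prod, rename_X]
  refine Finset.prod_equiv (Equiv.swap i j) (fun l => ?_) fun _ _ => rfl
  rcases eq_or_ne l i with rfl | hi
  · rw [Equiv.swap_apply_left, h]
  rcases eq_or_ne l j with rfl | hj
  · rw [Equiv.swap_apply_right, h]
  rw [Equiv.swap_apply_of_ne_of_ne hi hj]

lemma pderiv_prod_X {i : ι} {s : Finset ι} (h : i ∉ s) :
    pderiv i (∏ l ∈ s, (X l : MvPolynomial ι ℂ)) = 0 := by
  exact derivation_prod_eq_zero _ _ _ fun j hj => pderiv_X_of_ne (ne_of_mem_of_not_mem hj h)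

/-- The monomial whose exponents are `n` on `s` and `n + 1` elsewhere. -/
noncomputable def stair (n : ℕ) (s : Finset ι) : MvPolynomial ι ℂ :=
  (∏ l, X l) ^ n * ∏ l ∈ sᶜ, X l

lemma stair_eq {n : ℕ} {s : Finset ι} {k : ι} (hk : k ∉ s) :
    stair n s = X k * stair n (insert k s) := by
  rw [stair, stair, Finset.compl_insert, ← Finset.mul_prod_erase sᶜ _ (Finset.mem_compl.mpr hk)]
  ring

lemma dunkl_stair (a : ℂ) (n : ℕ) {s : Finset ι} {k : ι} (hk : k ∉ s) :
    dunkl a k (stair n s) = (n + 1 - a * s.card) • stair n (insert k s) := by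
  have hd : pderiv k (stair n s) = (n + 1 : ℂ) • stair n (insert k s) := by
    have h : stair n s = X k ^ (n + 1) *
        ((∏ l ∈ Finset.univ.erase k, X l) ^ n * ∏ l ∈ (insert k s)ᶜ, X l) := by
      rw [stair_eq hk, stair, ← Finset.mul_prod_erase _ _ (Finset.mem_univ k)]
      ring
    have h' : stair n (insert k s) = X k ^ n *
        ((∏ l ∈ Finset.univ.erase k, X l) ^ n * ∏ l ∈ (insert k s)ᶜ, X l) := by
      rw [stair, ← Finset.mul_prod_erase _ _ (Finset.mem_univ k)]
      ring
    rw [h, h', Derivation.leibniz, Derivation.leibniz, Derivation.leibniz_pow,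
      Derivation.leibniz_pow, pderiv_prod_X (by simp), pderiv_prod_X (by simp), pderiv_X_self]
    simp only [smul_zero, add_zero, smul_eq_mul, nsmul_eq_mul, Nat.add_sub_cancel, mul_one,
      mul_zero, zero_add, smul_eq_C_mul, map_add, map_natCast, C_1, Nat.cast_add, Nat.cast_one]
    ring
  have hδ : ∀ l, divDiff k l (stair n s) = if l ∈ s then stair n (insert k s) else 0 := fun l => by
    split_ifs with hl
    · have hkl : k ≠ l := fun e => hk (e ▸ hl)
      apply divDiff_eq_of_mul hkl
      rw [stair_eq hk, map_mul, rename_X, Equiv.swap_apply_left]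
      have : rename (Equiv.swap k l) (stair n (insert k s)) = stair n (insert k s) := by
        rw [stair, map_mul, map_pow, rename_swap_prod_X _ _ _ (by simp),
          rename_swap_prod_X _ _ _ (by simp [hl])]
      rw [this]
      ring
    · rcases eq_or_ne k l with rfl | hkl
      · simp
      apply divDiff_eq_of_mul hkl
      rw [stair, map_mul, map_pow, rename_swap_prod_X _ _ _ (by simp),
          rename_swap_prod_X _ _ _ (by simp [hl, hk]), sub_self, mul_zero]
  rw [dunkl_apply, hd]
  simp only [hδ, Finset.sum_ite_mem, Finset.univ_inter, Finset.sum_const, ← Nat.cast_smul_eq_nsmul ℂ,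
    smul_smul, sub_smul]

lemma dunklHom_prod_stair (a : ℂ) (n : ℕ) (s : Finset ι) :
    dunklHom a (∏ l ∈ s, X l) (stair n ∅) =
      (∏ j ∈ Finset.range s.card, (n + 1 - a * j)) • stair n s := by
  induction s using Finset.induction_on with
  | empty => simp
  | insert k s hk ih =>
    rw [Finset.prod_insert hk, map_mul, Module.End.mul_apply, ih, map_smul, dunklHom_X,
      dunkl_stair a n hk, smul_smul, Finset.card_insert_of_notMem hk, Finset.prod_range_succ]

lemma dunklHom_prod_pow_succ (a : ℂ) (n : ℕ) :
    dunklHom a (∏ l, X l) ((∏ l : ι, X l) ^ (n + 1)) =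
      (∏ j ∈ Finset.range (Fintype.card ι), (n + 1 - a * j)) • (∏ l, X l) ^ n := by
  simpa [stair, ← pow_succ] using dunklHom_prod_stair a n (Finset.univ : Finset ι)

lemma dunklHom_prod_eq_zero {a q : ℕ} (hq : Fintype.card ι = q + 1) :
    dunklHom (a : ℂ) (∏ l, X l) ((∏ l : ι, X l) ^ (a * q)) = 0 := by
  rcases h : a * q with - | n
  · have hc : 0 < Fintype.card ι := by omega
    obtain ⟨i⟩ := Fintype.card_pos_iff.mp hc
    rw [← Finset.prod_erase_mul _ _ (Finset.mem_univ i), map_mul, Module.End.mul_apply, dunklHom_X,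
      pow_zero, ← C_1, dunkl_C, map_zero]
  · rw [dunklHom_prod_pow_succ, Finset.prod_eq_zero (i := q) (by simp [hq]), zero_smul]
    rw [sub_eq_zero]
    exact_mod_cast h.symm

lemma exists_dunklHom_prod_pow_eq {a q : ℕ} (hq : Fintype.card ι = q + 1) (t : ℕ) :
    ∃ c : ℂ, c ≠ 0 ∧ (dunklHom (a : ℂ) (∏ l, X l) ^ t) ((∏ l : ι, X l) ^ (a * q + t)) =
      c • (∏ l, X l) ^ (a * q) := by
  induction t with
  | zero => exact ⟨1, one_ne_zero, by simp⟩
  | succ t ih =>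
    obtain ⟨c, hc, h⟩ := ih
    refine ⟨(∏ j ∈ Finset.range (Fintype.card ι), ((a * q + t : ℕ) + 1 - a * j : ℂ)) * c,
      mul_ne_zero (Finset.prod_ne_zero_iff.mpr fun j hj => ?_) hc, ?_⟩
    · rw [Finset.mem_range, hq, Nat.lt_succ_iff] at hj
      have := Nat.mul_le_mul_left a hj
      rw [sub_ne_zero]
      exact_mod_cast (by omega : a * q + t + 1 ≠ a * j)
    · rw [pow_succ, Module.End.mul_apply, ← add_assoc, dunklHom_prod_pow_succ, map_smul, h, smul_smul]

end Staircase

section Contraction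

open scoped TensorProduct
open Module

variable {ι κ : Type*} [DecidableEq ι] [DecidableEq κ] [Fintype ι] [Fintype κ]

lemma tensorComm_kernel (a : ℕ) :
    TensorProduct.comm ℂ _ _ (kernel ι κ a) = kernel κ ι a := comm_kernel a

lemma Intertwined.symm {a : ℕ} {P : MvPolynomial ι ℂ} {Q : MvPolynomial κ ℂ}
    (h : Intertwined ι κ a P Q) : Intertwined κ ι a Q P := by
  apply (Algebra.TensorProduct.comm ℂ _ _).injective
  rw [comm_lTensor, comm_kernel, h, ← comm_kernel (ι := ι) (κ := κ), ← comm_lTensor]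
  exact (TensorProduct.comm ℂ _ _).symm_apply_apply _

lemma contraction_lcoeff_kernel (a : ℕ) :
    contraction (kernel ι κ a) (lcoeff ℂ 0) = (∏ l, X l) ^ (a * Fintype.card κ) := by
  have h : ∀ f : TwoPoly ι κ, contraction f (lcoeff ℂ 0) =
      Algebra.TensorProduct.productMap (AlgHom.id ℂ (MvPolynomial ι ℂ))
        (aeval fun _ => 0 : MvPolynomial κ ℂ →ₐ[ℂ] MvPolynomial ι ℂ) f := fun f => by
    induction f using TensorProduct.induction_on with
    | zero => simp
    | add f g hf hg => simp only [map_add, LinearMap.add_apply, hf, hg]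
    | tmul p q =>
      rw [Algebra.TensorProduct.productMap_apply_tmul, aeval_zero', contraction_tmul, smul_eq_C_mul,
        mul_comm]
      rfl
  rw [h]
  simp only [kernel, linForm, map_prod, map_pow, map_add, Algebra.TensorProduct.productMap_apply_tmul]
  simp [Fintype.prod_prod_type, Finset.prod_pow, pow_mul, pow_right_comm]

end Contraction

section Rank

open scoped TensorProduct
open Module

variable {ι κ : Type*} [DecidableEq ι] [DecidableEq κ] [Fintype ι] [Fintype κ] {a : ℕ}

lemma map_dunklHom_range_le (ha : 1 ≤ a) {P : MvPolynomial ι ℂ} (hP : P.IsSymmetric) :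
    (LinearMap.range (contraction (kernel ι κ a))).map (dunklHom (a : ℂ) P) ≤
      LinearMap.range (contraction (kernel ι κ a)) := by
  obtain ⟨Q, -, hQ⟩ := exists_intertwined (ι := κ) ha hP
  rintro _ ⟨_, ⟨θ, rfl⟩, rfl⟩
  rw [← contraction_rTensor, hQ.symm, contraction_lTensor]
  exact LinearMap.mem_range_self _ _

lemma pairing_rename (c : ℂ) (σ : Equiv.Perm ι) (P f : MvPolynomial ι ℂ) :
    pairing c (rename σ P) (rename σ f) = pairing c P f := by
  have h := LinearMap.congr_fun (permEnd_mul_dunklHom c σ P) f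
  simp only [Module.End.mul_apply, permEnd_apply] at h
  rw [pairing, ← h, constantCoeff_rename_perm, pairing]

lemma eq_zero_of_symmetric_pairing_eq_zero (ha : 1 ≤ a) {q : ℕ} {g : MvPolynomial (Fin q) ℂ}
    (hg : g.IsSymmetric) (h : ∀ P : MvPolynomial (Fin q) ℂ, P.IsSymmetric → pairing (a : ℂ) P g = 0) :
    g = 0 := by
  refine eq_zero_of_pairing_eq_zero ha fun P => ?_
  have h1 := h (∑ σ : Equiv.Perm (Fin q), rename σ P) fun τ => by
    rw [map_sum]
    refine Fintype.sum_equiv (Equiv.mulLeft τ) _ _ fun σ => ?_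
    rw [rename_rename]
    rfl
  have h2 : ∀ σ : Equiv.Perm (Fin q), pairing (a : ℂ) (rename σ P) g = pairing (a : ℂ) P g :=
    fun σ => by rw [← pairing_rename (a : ℂ) σ P g, hg σ]
  rw [pairing, map_sum, LinearMap.sum_apply, map_sum] at h1
  change ∑ σ : Equiv.Perm (Fin q), pairing (a : ℂ) (rename σ P) g = 0 at h1
  simp only [h2, Finset.sum_const, Finset.card_univ, smul_eq_zero] at h1
  exact h1.resolve_left Fintype.card_ne_zero

/-- The space obtained by applying all symmetric polynomials in the Dunkl operators. -/
noncomputable def symmOrbit (c : ℂ) (f : MvPolynomial ι ℂ) : Submodule ℂ (MvPolynomial ι ℂ) :=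
  (Subalgebra.toSubmodule (symmetricSubalgebra ι ℂ)).map
    (LinearMap.applyₗ f ∘ₗ (dunklHom c).toLinearMap)

lemma dunklHom_mem_symmOrbit (c : ℂ) (f : MvPolynomial ι ℂ) {P : MvPolynomial ι ℂ}
    (hP : P.IsSymmetric) : dunklHom c P f ∈ symmOrbit c f :=
  ⟨P, hP, rfl⟩

lemma range_contraction_kernel_le_symmOrbit (ha : 1 ≤ a) (q : ℕ) :
    LinearMap.range (contraction (kernel ι (Fin q) a)) ≤
      symmOrbit (a : ℂ) ((∏ l, X l) ^ (a * q)) := by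
  refine range_contraction_le fun l hl => ?_
  rw [tensorComm_kernel]
  refine eq_zero_of_symmetric_pairing_eq_zero ha (fun σ => ?_) fun P hP => ?_
  · rw [← permEnd_apply, ← contraction_rTensor, rTensor_permEnd, leftPerm_kernel]
  · obtain ⟨R, hR, h⟩ := exists_intertwined (ι := ι) ha hP
    change lcoeff ℂ 0 _ = 0
    rw [← contraction_rTensor, h.symm, contraction_lTensor, apply_contraction, tensorComm_kernel,
      contraction_lcoeff_kernel, Fintype.card_fin]
    exact hl _ (dunklHom_mem_symmOrbit _ _ hR)

lemma succ_mul_finrank_le (ha : 1 ≤ a) (q : ℕ) :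
    (a + 1) * finrank ℂ (LinearMap.range (contraction (kernel (Fin (q + 1)) (Fin q) a))) ≤
      finrank ℂ (LinearMap.range (contraction (kernel (Fin (q + 1)) (Fin (q + 1)) a))) := by
  set U := symmOrbit (a : ℂ) ((∏ l : Fin (q + 1), X l) ^ (a * q)) with hU
  set W := LinearMap.range (contraction (kernel (Fin (q + 1)) (Fin (q + 1)) a)) with hW
  set E := dunklHom (a : ℂ) (∏ l : Fin (q + 1), X l) with hE
  have hsymm : (∏ l : Fin (q + 1), X l : MvPolynomial (Fin (q + 1)) ℂ).IsSymmetric := fun σ => by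
    rw [map_prod]
    exact Fintype.prod_equiv σ _ _ fun _ => rename_X _ _
  have hEW : W.map E ≤ W := map_dunklHom_range_le ha hsymm
  have hcomm : ∀ P f, dunklHom (a : ℂ) P (E f) = E (dunklHom (a : ℂ) P f) := fun P f => by
    rw [hE, ← Module.End.mul_apply, ← Module.End.mul_apply, ← map_mul, ← map_mul, mul_comm]
  have hUE : U ≤ LinearMap.ker E := by
    rintro _ ⟨P, -, rfl⟩
    change E (dunklHom _ P _) = 0
    rw [← hcomm, dunklHom_prod_eq_zero (by simp), map_zero]
  have hcomm' : ∀ n P f, dunklHom (a : ℂ) P ((E ^ n) f) = (E ^ n) (dunklHom (a : ℂ) P f) :=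
    fun n P f => by
      rw [hE, ← map_pow, ← Module.End.mul_apply, ← Module.End.mul_apply, ← map_mul, ← map_mul,
        mul_comm]
  have hUW : U ≤ W.map (E ^ a) := by
    rintro _ ⟨P, hP, rfl⟩
    obtain ⟨c, hc, h⟩ := exists_dunklHom_prod_pow_eq (ι := Fin (q + 1)) (a := a) (q := q) (by simp) a
    refine ⟨c⁻¹ • dunklHom (a : ℂ) P ((∏ l, X l) ^ (a * q + a)), W.smul_mem _ ?_, ?_⟩
    · refine map_dunklHom_range_le ha hP ⟨_, ⟨lcoeff ℂ 0, ?_⟩, rfl⟩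
      rw [contraction_lcoeff_kernel, Fintype.card_fin, mul_add_one]
    · rw [map_smul, ← hcomm', h, map_smul, smul_smul, inv_mul_cancel₀ hc, one_smul]
      rfl
  refine le_trans ?_ (mul_finrank_le_of_le_ker hUE a hEW hUW)
  have : FiniteDimensional ℂ U := Submodule.finiteDimensional_of_le hUW
  exact Nat.mul_le_mul_left _ (Submodule.finrank_mono (range_contraction_kernel_le_symmOrbit ha q))

end Rank

section BinaryForms

lemma eq_sum_of_isHomogeneous_fin_two {R : Type*} [CommRing R] {F : MvPolynomial (Fin 2) R} {d : ℕ}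
    (hF : F.IsHomogeneous d) :
    F = ∑ j : Fin (d + 1), C (coeff (Finsupp.single 0 (j : ℕ) + Finsupp.single 1 (d - j)) F) *
      X 0 ^ (j : ℕ) * X 1 ^ (d - (j : ℕ)) := by
  have key : ∀ j : ℕ, C (coeff (Finsupp.single 0 j + Finsupp.single 1 (d - j)) F) *
      X 0 ^ j * X 1 ^ (d - j) = monomial (Finsupp.single (0 : Fin 2) j + Finsupp.single 1 (d - j))
        (coeff (Finsupp.single 0 j + Finsupp.single 1 (d - j)) F) := fun j => by
    rw [X_pow_eq_monomial, X_pow_eq_monomial, mul_assoc, monomial_mul, C_mul_monomial, mul_one,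
      mul_one]
  simp_rw [key]
  ext m
  rw [coeff_sum]
  simp_rw [coeff_monomial]
  by_cases hm : m.degree = d
  · have hm' : m 0 + m 1 = d := by
      rw [← hm, Finsupp.degree_eq_sum, Fin.sum_univ_two]
    have he : Finsupp.single 0 (m 0) + Finsupp.single 1 (d - m 0) = m := by
      ext i
      fin_cases i
      · simp
      · simp; omega
    rw [Finset.sum_eq_single (⟨m 0, by omega⟩ : Fin (d + 1))]
    · simp only [he, if_true]
    · intro j _ hj
      rw [if_neg]
      rintro rfl
      apply hj
      ext
      simp
    · simp
  · rw [hF.coeff_eq_zero hm, Finset.sum_eq_zero]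
    intro j _
    rw [if_neg]
    rintro rfl
    apply hm
    have := j.2
    simp [Finsupp.degree_eq_sum]
    omega

lemma isHomogeneous_genForm (b : ℕ) : (genForm b).IsHomogeneous b := by
  refine IsHomogeneous.sum _ _ _ fun i _ => ?_
  have := ((isHomogeneous_C (Fin 2) (X i : MvPolynomial (Fin (b + 1)) ℂ)).mul
    (isHomogeneous_X_pow (R := MvPolynomial (Fin (b + 1)) ℂ) (0 : Fin 2) i)).mul
    (isHomogeneous_X_pow (R := MvPolynomial (Fin (b + 1)) ℂ) (1 : Fin 2) (b - i))
  convert this using 1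
  have := i.2
  omega

lemma pow_sum_mul_pow {A : Type*} [CommRing A] {b : ℕ} (φ : MvPolynomial (Fin (b + 1)) ℂ →+* A)
    (a : ℕ) (t : A) :
    (∑ i : Fin (b + 1), φ (X i) * t ^ (i : ℕ)) ^ a =
      ∑ j : Fin (a * b + 1), φ (coeffC a b j) * t ^ (j : ℕ) := by
  have h : (genForm b ^ a).IsHomogeneous (a * b) := by
    rw [mul_comm]
    exact (isHomogeneous_genForm b).pow a
  have h2 := congrArg (eval₂Hom φ ![t, 1]) (eq_sum_of_isHomogeneous_fin_two h)
  simpa [genForm, map_sum, coeffC] using h2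

lemma isHomogeneous_coeff_genForm_pow (b n : ℕ) (m : Fin 2 →₀ ℕ) :
    (coeff m (genForm b ^ n)).IsHomogeneous n := by
  have h1 : ∀ m : Fin 2 →₀ ℕ, (coeff m (genForm b)).IsHomogeneous 1 := fun m => by
    rw [genForm, coeff_sum]
    refine IsHomogeneous.sum _ _ _ fun i _ => ?_
    rw [X_pow_eq_monomial, X_pow_eq_monomial, mul_assoc, monomial_mul, C_mul_monomial,
      coeff_monomial]
    split_ifs
    · simpa using isHomogeneous_X ℂ i
    · exact isHomogeneous_zero _ _ _
  induction n generalizing m with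
  | zero =>
    rw [pow_zero, coeff_one]
    split_ifs
    · exact isHomogeneous_one _ _
    · exact isHomogeneous_zero _ _ _
  | succ n ih =>
    rw [pow_succ, coeff_mul]
    exact IsHomogeneous.sum _ _ _ fun p _ => (ih _).mul (h1 _)

lemma isHomogeneous_coeffC (a b j : ℕ) : (coeffC a b j).IsHomogeneous a :=
  isHomogeneous_coeff_genForm_pow b a _

lemma isHomogeneous_FH {a b k : ℕ} {P : MvPolynomial (Fin (a * b + 1)) ℂ} (hP : P.IsHomogeneous k) :
    (FH a b P).IsHomogeneous (a * k) :=
  hP.aeval _ fun _ => isHomogeneous_coeffC a b _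

end BinaryForms

section Specialization

open scoped TensorProduct
open Module

/-- Specialise the coefficients of a binary form of degree `q` to those of `∏ l, (t + y_l)`. -/
noncomputable def spec (q : ℕ) : MvPolynomial (Fin (q + 1)) ℂ →ₐ[ℂ] MvPolynomial (Fin q) ℂ :=
  aeval fun i => esymm (Fin q) ℂ (q - i)

lemma prod_add_eq_sum_spec {A : Type*} [CommRing A] {q : ℕ} (φ : MvPolynomial (Fin q) ℂ →+* A)
    (t : A) : ∏ l, (t + φ (X l)) = ∑ i : Fin (q + 1), φ (spec q (X i)) * t ^ (i : ℕ) := by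
  have h := congrArg (Polynomial.eval₂ φ t) (prod_C_add_X_eq_sum_esymm ℂ (Fin q))
  rw [Polynomial.eval₂_finsetProd, Polynomial.eval₂_finsetSum] at h
  simp only [Polynomial.eval₂_add, Polynomial.eval₂_X, Polynomial.eval₂_C, Polynomial.eval₂_mul,
    Polynomial.eval₂_pow, Fintype.card_fin] at h
  rw [h, ← Finset.sum_range_reflect, Finset.sum_range]
  refine Finset.sum_congr rfl fun i _ => ?_
  have := i.2
  simp only [spec, aeval_X]
  congr 2
  omega

lemma linForm_prod_pow (q p a : ℕ) (j : Fin p) :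
    ∏ l : Fin q, linForm (l, j) ^ a = ∑ n : Fin (a * q + 1),
      spec q (coeffC a q n) ⊗ₜ[ℂ] ((X j : MvPolynomial (Fin p) ℂ) ^ (n : ℕ)) := by
  rw [Finset.prod_pow]
  let φ : MvPolynomial (Fin q) ℂ →+* TwoPoly (Fin q) (Fin p) :=
    (Algebra.TensorProduct.includeLeft : _ →ₐ[ℂ] TwoPoly (Fin q) (Fin p)).toRingHom
  have h := prod_add_eq_sum_spec φ ((1 : MvPolynomial (Fin q) ℂ) ⊗ₜ[ℂ] (X j : MvPolynomial (Fin p) ℂ))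
  have h2 := pow_sum_mul_pow (φ.comp (spec q).toRingHom) a
    ((1 : MvPolynomial (Fin q) ℂ) ⊗ₜ[ℂ] (X j : MvPolynomial (Fin p) ℂ))
  have h3 : ∏ l : Fin q, linForm (l, j) =
      ∏ l : Fin q, ((1 : MvPolynomial (Fin q) ℂ) ⊗ₜ[ℂ] (X j : MvPolynomial (Fin p) ℂ) + φ (X l)) :=
    Finset.prod_congr rfl fun l _ => add_comm _ _
  rw [h3, h]
  refine h2.trans (Finset.sum_congr rfl fun n _ => ?_)
  rw [Algebra.TensorProduct.tmul_pow, one_pow]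
  change (spec q (coeffC a q n) ⊗ₜ[ℂ] (1 : MvPolynomial (Fin p) ℂ)) * _ = _
  rw [Algebra.TensorProduct.tmul_mul_tmul, mul_one, one_mul]

lemma kernel_eq_sum (q p a : ℕ) :
    kernel (Fin q) (Fin p) a = ∑ J : Fin p → Fin (a * q + 1),
      spec q (FH a q (∏ j, X (J j))) ⊗ₜ[ℂ]
        monomial (Finsupp.equivFunOnFinite.symm fun j => (J j : ℕ)) (1 : ℂ) := by
  rw [kernel, Fintype.prod_prod_type_right]
  simp_rw [linForm_prod_pow]
  rw [Finset.prod_univ_sum, Fintype.piFinset_univ]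
  refine Finset.sum_congr rfl fun J _ => ?_
  have : ∀ (s : Finset (Fin p)) (f : Fin p → MvPolynomial (Fin q) ℂ)
      (g : Fin p → MvPolynomial (Fin p) ℂ),
      ∏ j ∈ s, (f j ⊗ₜ[ℂ] g j) = (∏ j ∈ s, f j) ⊗ₜ[ℂ] ∏ j ∈ s, g j := fun s f g => by
    induction s using Finset.cons_induction with
    | empty => rfl
    | cons i s hi ih => simp only [Finset.prod_cons, ih, Algebra.TensorProduct.tmul_mul_tmul]
  rw [this, map_prod, map_prod]
  congr 1
  · simp [FH]
  · rw [monomial_eq, map_one, one_mul, Finsupp.prod_fintype _ _ fun _ => pow_zero _]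
    simp

lemma homogeneousSubmodule_le_span_prod (σ : Type*) (p : ℕ) :
    homogeneousSubmodule σ ℂ p ≤
      Submodule.span ℂ (Set.range fun J : Fin p → σ => ∏ j, (X (J j) : MvPolynomial σ ℂ)) := by
  rw [← homogeneousSubmodule_one_pow, homogeneousSubmodule_one_eq_span_X, Submodule.span_pow]
  refine Submodule.span_mono fun f hf => ?_
  obtain ⟨g, rfl⟩ := Set.mem_pow.1 hf
  choose J hJ using fun i => (g i).2
  exact ⟨J, by simp [List.prod_ofFn, hJ]⟩

lemma range_contraction_kernel (q p a : ℕ) :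
    LinearMap.range (contraction (kernel (Fin q) (Fin p) a)) =
      (homogeneousSubmodule (Fin (a * q + 1)) ℂ p).map ((spec q).comp (FH a q)).toLinearMap := by
  apply le_antisymm
  · rintro _ ⟨θ, rfl⟩
    rw [kernel_eq_sum, map_sum, LinearMap.sum_apply]
    refine Submodule.sum_mem _ fun J _ => ?_
    rw [contraction_tmul]
    refine Submodule.smul_mem _ _ ⟨_, ?_, rfl⟩
    simpa using IsHomogeneous.prod Finset.univ _ _ fun j _ => isHomogeneous_X ℂ (J j)
  · refine (Submodule.map_mono (homogeneousSubmodule_le_span_prod _ p)).trans ?_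
    rw [Submodule.map_span_le]
    rintro _ ⟨J, rfl⟩
    refine ⟨lcoeff ℂ (Finsupp.equivFunOnFinite.symm fun j => (J j : ℕ)), ?_⟩
    rw [kernel_eq_sum, map_sum, LinearMap.sum_apply, Finset.sum_eq_single J]
    · simp [contraction_tmul, lcoeff_apply]
    · intro J' _ hJ
      rw [contraction_tmul, lcoeff_apply, coeff_monomial, if_neg, zero_smul]
      intro h
      apply hJ
      funext j
      exact Fin.ext (congrFun (Finsupp.equivFunOnFinite.symm.injective h) j)
    · simp

lemma eval_eq_zero_of_spec_eq_zero {q N : ℕ} {P : MvPolynomial (Fin (q + 1)) ℂ}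
    (hP : P.IsHomogeneous N) (h : spec q P = 0) (v : Fin (q + 1) → ℂ) (hv : v (Fin.last q) ≠ 0) :
    eval v P = 0 := by
  let δ : MvPolynomial (Fin (q + 1)) ℂ →ₐ[ℂ] MvPolynomial (Fin q) ℂ :=
    aeval (Fin.lastCases 1 fun i => X i.rev)
  have hδ : ((Subalgebra.val _).comp (esymmAlgHom (Fin q) ℂ q)).comp δ = spec q := by
    refine algHom_ext fun i => ?_
    induction i using Fin.lastCases with
    | last => simp [δ, spec]
    | cast i =>
      have := i.2
      simp [δ, spec, esymmAlgHom]
      congr 1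
      omega
  have h0 : δ P = 0 := by
    apply esymmAlgHom_injective (σ := Fin q) (R := ℂ) (n := q) (by simp)
    apply Subtype.ext
    rw [map_zero]
    exact (AlgHom.congr_fun hδ P).trans h
  let w : Fin (q + 1) → ℂ := fun i => v i / v (Fin.last q)
  have hw : (aeval fun i : Fin q => w i.rev.castSucc).comp δ = (aeval w : _ →ₐ[ℂ] ℂ) := by
    refine algHom_ext fun i => ?_
    induction i using Fin.lastCases with
    | last => simp [δ, w, hv]
    | cast i => simp [δ]
  have h1 : eval w P = 0 := by
    have := AlgHom.congr_fun hw P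
    rw [AlgHom.comp_apply, h0, map_zero] at this
    exact this.symm
  have hvw : v = v (Fin.last q) • w := by
    funext i
    simp [w, mul_div_cancel₀ _ hv]
  rw [hvw, eval_eq]
  rw [eval_eq] at h1
  rw [← mul_zero (v (Fin.last q) ^ N), ← h1, Finset.mul_sum]
  refine Finset.sum_congr rfl fun d hd => ?_
  simp only [Pi.smul_apply, smul_eq_mul, mul_pow, Finset.prod_mul_distrib, Finset.prod_pow_eq_pow_sum]
  rw [hP.degree_eq_sum_deg_support hd]
  ring

lemma eq_zero_of_spec_eq_zero {q N : ℕ} {P : MvPolynomial (Fin (q + 1)) ℂ}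
    (hP : P.IsHomogeneous N) (h : spec q P = 0) : P = 0 := by
  have : P * X (Fin.last q) = 0 := by
    refine MvPolynomial.funext fun v => ?_
    by_cases hv : v (Fin.last q) = 0
    · simp [hv]
    · simp [eval_eq_zero_of_spec_eq_zero hP h v hv]
  exact (mul_eq_zero.1 this).resolve_right (X_ne_zero _)

lemma finrank_homogeneousSubmodule (n N : ℕ) :
    finrank ℂ (homogeneousSubmodule (Fin (n + 1)) ℂ N) = (N + n).choose n := by
  rw [homogeneousSubmodule_eq_finsupp_supported]
  rw [(AddMonoidAlgebra.supportedEquivFinsupp (R := ℂ) (S := ℂ) _).finrank_eq]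
  have hs : {d : Fin (n + 1) →₀ ℕ | d.degree = N} =
      ((Finset.univ.finsuppAntidiag N : Finset (Fin (n + 1) →₀ ℕ)) : Set _) := by
    ext d
    simp [Finsupp.degree_eq_sum]
  rw [hs, finrank_finsupp_self, ← Nat.card_eq_fintype_card, Nat.card_coe_set_eq, Set.ncard_coe_finset,
    Finset.card_finsuppAntidiag_nat_eq_choose,
    Finset.card_univ, Fintype.card_fin, ← Nat.choose_symm_add]
  congr 1
  omega

lemma finiteDimensional_homogeneousSubmodule (n N : ℕ) :
    FiniteDimensional ℂ (homogeneousSubmodule (Fin (n + 1)) ℂ N) := by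
  refine FiniteDimensional.of_finrank_pos ?_
  rw [finrank_homogeneousSubmodule]
  exact Nat.choose_pos (by omega)

end Specialization

section Surjectivity

open Module

/-- Surjectivity of the Foulkes–Howe map in degree `k`. -/
def SurjectiveInDegree (a b k : ℕ) : Prop :=
  homogeneousSubmodule (Fin (b + 1)) ℂ (a * k) ≤
    (homogeneousSubmodule (Fin (a * b + 1)) ℂ k).map (FH a b).toLinearMap

lemma map_FH_le (a b k : ℕ) :
    (homogeneousSubmodule (Fin (a * b + 1)) ℂ k).map (FH a b).toLinearMap ≤
      homogeneousSubmodule (Fin (b + 1)) ℂ (a * k) := by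
  rintro _ ⟨P, hP, rfl⟩
  exact isHomogeneous_FH hP

lemma finrank_map_spec (q N : ℕ) :
    finrank ℂ ((homogeneousSubmodule (Fin (q + 1)) ℂ N).map (spec q).toLinearMap) =
      (N + q).choose q := by
  rw [← finrank_homogeneousSubmodule, ← LinearMap.range_domRestrict]
  refine LinearMap.finrank_range_of_inj ((injective_iff_map_eq_zero _).2 fun P hP => ?_)
  exact Subtype.ext (eq_zero_of_spec_eq_zero P.2 hP)

lemma SurjectiveInDegree.diagonal {a q : ℕ} (ha : 1 ≤ a) (h : SurjectiveInDegree a q (q + 1)) :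
    SurjectiveInDegree a (q + 1) (q + 1) := by
  have := finiteDimensional_homogeneousSubmodule (q + 1) (a * (q + 1))
  have := finiteDimensional_homogeneousSubmodule (a * (q + 1)) (q + 1)
  have := finiteDimensional_homogeneousSubmodule (a * q) (q + 1)
  have h1 : (a * (q + 1) + q).choose q ≤
      finrank ℂ (LinearMap.range (contraction (kernel (Fin q) (Fin (q + 1)) a))) := by
    rw [← finrank_map_spec, range_contraction_kernel, AlgHom.comp_toLinearMap, Submodule.map_comp]
    exact Submodule.finrank_mono (Submodule.map_mono h)
  have h2 := finrank_range_contraction_comm_le (kernel (Fin (q + 1)) (Fin q) a)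
  rw [tensorComm_kernel] at h2
  have h3 := succ_mul_finrank_le ha q
  rw [range_contraction_kernel (q + 1) (q + 1), AlgHom.comp_toLinearMap, Submodule.map_comp] at h3
  have h4 := Submodule.finrank_map_le (spec (q + 1)).toLinearMap
    ((homogeneousSubmodule (Fin (a * (q + 1) + 1)) ℂ (q + 1)).map (FH a (q + 1)).toLinearMap)
  refine (Submodule.eq_of_le_of_finrank_le (map_FH_le a (q + 1) (q + 1)) ?_).ge
  rw [finrank_homogeneousSubmodule]
  have h5 := Nat.add_one_mul_choose_eq (a * (q + 1) + q) q
  have h6 : (a * (q + 1) + (q + 1)).choose (q + 1) = (a + 1) * (a * (q + 1) + q).choose q := by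
    have h7 : a * (q + 1) + q + 1 = (a + 1) * (q + 1) := by ring
    rw [← add_assoc]
    refine Nat.eq_of_mul_eq_mul_right q.succ_pos ?_
    rw [Nat.succ_eq_add_one, ← h5, h7]
    ring
  rw [h6]
  exact (Nat.mul_le_mul_left _ (h1.trans h2)).trans (h3.trans h4)

/-- Substitution for `X i` of the generic form evaluated at the point `(i, 1)`. -/
noncomputable def vandermondeHom (b : ℕ) :
    MvPolynomial (Fin (b + 1)) ℂ →ₐ[ℂ] MvPolynomial (Fin (b + 1)) ℂ :=
  aeval fun i => ∑ j : Fin (b + 1), C (Matrix.vandermonde (fun i : Fin (b + 1) => (i : ℂ)) i j) * X j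

lemma isHomogeneous_vandermondeHom {b n : ℕ} {P : MvPolynomial (Fin (b + 1)) ℂ}
    (hP : P.IsHomogeneous n) : (vandermondeHom b P).IsHomogeneous n := by
  rw [← one_mul n]
  exact hP.aeval _ fun i => IsHomogeneous.sum _ _ _ fun j _ => isHomogeneous_C_mul_X _ _

lemma exists_vandermondeHom_comp (b : ℕ) :
    ∃ τ : Fin (b + 1) → MvPolynomial (Fin (b + 1)) ℂ, (∀ i, (τ i).IsHomogeneous 1) ∧
      (vandermondeHom b).comp (aeval τ) = AlgHom.id ℂ _ := by
  set V := Matrix.vandermonde (fun i : Fin (b + 1) => (i : ℂ)) with hV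
  have hdet : IsUnit V.det := by
    rw [isUnit_iff_ne_zero, hV, Matrix.det_vandermonde_ne_zero_iff]
    intro i j h
    exact Fin.ext (Nat.cast_injective h)
  refine ⟨fun j => ∑ i, C (V⁻¹ j i) * X i, fun j => ?_, ?_⟩
  · exact IsHomogeneous.sum _ _ _ fun i _ => isHomogeneous_C_mul_X _ _
  · refine algHom_ext fun j => ?_
    simp only [AlgHom.comp_apply, aeval_X, map_sum, map_mul, vandermondeHom, AlgHom.id_apply,
      Finset.mul_sum, ← hV, algHom_C, algebraMap_eq]
    rw [Finset.sum_comm]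
    have : ∀ l : Fin (b + 1), ∑ i : Fin (b + 1), (C (V⁻¹ j i) * (C (V i l) * X l)) =
        C ((1 : Matrix (Fin (b + 1)) (Fin (b + 1)) ℂ) j l) * (X l : MvPolynomial (Fin (b + 1)) ℂ) :=
      fun l => by
        rw [← Matrix.nonsing_inv_mul V hdet, Matrix.mul_apply, map_sum, Finset.sum_mul]
        refine Finset.sum_congr rfl fun i _ => ?_
        rw [map_mul, mul_assoc]
    simp_rw [this, Matrix.one_apply]
    simp

lemma exists_FH_eq_vandermondeHom_X_pow (a b : ℕ) (i : Fin (b + 1)) :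
    ∃ P : MvPolynomial (Fin (a * b + 1)) ℂ, P.IsHomogeneous 1 ∧
      FH a b P = vandermondeHom b (X i) ^ a := by
  refine ⟨∑ j : Fin (a * b + 1), C ((i : ℂ) ^ (j : ℕ)) * X j,
    IsHomogeneous.sum _ _ _ fun j _ => isHomogeneous_C_mul_X _ _, ?_⟩
  have h := pow_sum_mul_pow (RingHom.id (MvPolynomial (Fin (b + 1)) ℂ)) a (C (i : ℂ))
  simp only [vandermondeHom, aeval_X, Matrix.vandermonde_apply, FH, map_sum, map_mul, algHom_C,
    algebraMap_eq, map_pow, RingHom.id_apply] at h ⊢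
  simp_rw [mul_comm (C (i : ℂ) ^ _)]
  exact h.symm

lemma SurjectiveInDegree.succ {a b k : ℕ} (ha : 1 ≤ a) (hk : b ≤ k)
    (h : SurjectiveInDegree a b k) : SurjectiveInDegree a b (k + 1) := by
  intro Q hQ
  obtain ⟨τ, hτ, hcomp⟩ := exists_vandermondeHom_comp b
  have hQ' : (aeval τ Q).IsHomogeneous (a * (k + 1)) := by
    simpa using IsHomogeneous.aeval hQ τ hτ
  rw [← AlgHom.id_apply (R := ℂ) Q, ← hcomp, AlgHom.comp_apply, (aeval τ Q).as_sum, map_sum]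
  refine Submodule.sum_mem _ fun m hm => ?_
  have hdeg : ∑ i, m i = a * (k + 1) := by
    rw [← Finsupp.degree_eq_sum]
    by_contra hne
    exact mem_support_iff.1 hm (hQ'.coeff_eq_zero hne)
  obtain ⟨i, hi⟩ : ∃ i, a ≤ m i := by
    by_contra! hlt
    have h1 : ∑ i, m i ≤ ∑ _i : Fin (b + 1), (a - 1) :=
      Finset.sum_le_sum fun i _ => Nat.le_sub_one_of_lt (hlt i)
    rw [hdeg, Finset.sum_const, Finset.card_univ, Fintype.card_fin, smul_eq_mul] at h1
    obtain ⟨c, rfl⟩ := Nat.exists_eq_add_of_le' ha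
    simp only [Nat.add_sub_cancel] at h1
    nlinarith
  obtain ⟨m', rfl⟩ : ∃ m', m = Finsupp.single i a + m' :=
    exists_add_of_le (Finsupp.single_le_iff.2 hi)
  have hm' : m'.degree = a * k := by
    rw [← Finsupp.degree_eq_sum, map_add, Finsupp.degree_single, mul_add, mul_one] at hdeg
    omega
  obtain ⟨P, hP, hPe⟩ := exists_FH_eq_vandermondeHom_X_pow a b i
  generalize coeff (Finsupp.single i a + m') (aeval τ Q) = c
  have hR := isHomogeneous_vandermondeHom (isHomogeneous_monomial c hm')
  obtain ⟨P', hP', hPe'⟩ := h hR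
  rw [AlgHom.toLinearMap_apply] at hPe'
  have hmul : vandermondeHom b (monomial (Finsupp.single i a + m') c) = FH a b (P * P') := by
    rw [map_mul, hPe, hPe', ← map_pow, X_pow_eq_monomial, ← map_mul, monomial_mul, one_mul]
  rw [hmul]
  refine Submodule.mem_map_of_mem (f := (FH a b).toLinearMap) ?_
  rw [add_comm k]
  exact IsHomogeneous.mul hP hP'

lemma surjectiveInDegree_zero (a k : ℕ) : SurjectiveInDegree a 0 k := by
  have h : coeffC a 0 0 = X 0 ^ a := by
    have h := pow_sum_mul_pow (RingHom.id (MvPolynomial (Fin (0 + 1)) ℂ)) a 1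
    simp only [one_pow, mul_one, RingHom.id_apply] at h
    change (∑ i : Fin 1, X i) ^ a = ∑ j : Fin 1, coeffC a 0 j at h
    simpa using h.symm
  refine (homogeneousSubmodule_le_span_prod _ _).trans (Submodule.span_le.2 ?_)
  rintro _ ⟨J, rfl⟩
  refine ⟨X 0 ^ k, isHomogeneous_X_pow _ _, ?_⟩
  have hJ : ∀ j, J j = 0 := fun j => Subsingleton.elim (α := Fin 1) _ _
  simp [FH, hJ, pow_mul, h]

theorem surjectiveInDegree_of_le {a b k : ℕ} (ha : 1 ≤ a) (hk : b ≤ k) :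
    SurjectiveInDegree a b k := by
  induction b generalizing k with
  | zero => exact surjectiveInDegree_zero a k
  | succ q ih =>
    induction k, hk using Nat.le_induction with
    | base => exact (ih q.le_succ).diagonal ha
    | succ k hk ihk => exact ihk.succ ha hk

end Surjectivity

end Dunkl

/-- For `k ≥ b`, the Foulkes–Howe map is surjective in degree `k`. -/
theorem foulkesHowe_surjective_high_degree (a b : ℕ) (ha : 1 ≤ a) (hb : 1 ≤ b)
    (k : ℕ) (hk : b ≤ k) (Q : MvPolynomial (Fin (b + 1)) ℂ)
    (hQ : Q.IsHomogeneous (a * k)) :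
    ∃ P : MvPolynomial (Fin (a * b + 1)) ℂ, P.IsHomogeneous k ∧ FH a b P = Q := by
  exact Dunkl.surjectiveInDegree_of_le ha hk hQ
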